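/- arXiv:2307.03144 — 4 statements merged into one kernel-verified Lean document; each statement's English description precedes it below -/
import Mathlib

section
/- Let n be a nonzero integer, r₂ ∈ ℝ, r₁ ∈ ℂ with Re(r₁) < −1, and P ∈ ℤ with P ≤ −3 − |r₂|. Then all sums below converge absolutely and ∑_{n₁+n₂=n, n₁,n₂∈ℤ∖{0}} σ_{r₁}(n₁)·σ_{r₂}(n₂)·n₂^P = − n^P σ_{r₂}(n) ζ(−r₁) + (−1)^P·2·δ_{2∣P}·ζ(−P)·ζ(−r₂−P)·∑_{d∈ℕ, d∣|n|} d^{r₁+P} ∏_{p∣d, p prime} (1 + (1−p^P)·(p^{r₂} + p^{2r₂} + ⋯ + p^{v_p(d)·r₂})) + (−1)^P ∑_{d∈ℕ, d∤n} d^{r₁+r₂+2P} ∑_{0<c'≤d, gcd(c',d)∣n} gcd(c',d)^{−P}·ζ(−r₂−P, c'/d)·∑_{m∈ℤ} (m+u_{c',d})^P. -/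
open scoped BigOperators

/-- The divisor function `σ_ν(m) = ∑_{d ∣ |m|} d^ν` for `ν ∈ ℂ` and `m ∈ ℤ`. -/
noncomputable def dsigma (ν : ℂ) (m : ℤ) : ℂ := ∑ d ∈ m.natAbs.divisors, (d : ℂ) ^ ν

/-- The Hurwitz zeta function `ζ(s, a)`, meromorphically continued in `s`. -/
noncomputable def hzeta (s : ℂ) (a : ℝ) : ℂ := HurwitzZeta.hurwitzZeta (a : UnitAddCircle) s

/-- `b` is an element of `B_{c,d} = {b : ∃ a, a·d − b·c = n}` of minimal absolute value. -/
def IsMinAbsB (n : ℤ) (c d : ℕ) (b : ℤ) : Prop :=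
  (∃ a : ℤ, a * d - b * c = n) ∧ ∀ b' : ℤ, (∃ a : ℤ, a * d - b' * c = n) → |b| ≤ |b'|

/-- `u_{c,d} = b*·gcd(c,d)/d`, given the minimizing element `b` of `B_{c,d}`. -/
noncomputable def uval (c d : ℕ) (b : ℤ) : ℝ := ((b * Nat.gcd c d : ℤ) : ℝ) / (d : ℝ)

lemma dsigma_zero (ν : ℂ) : dsigma ν 0 = 0 := by simp [dsigma]

lemma dsigma_natCast_mul_of_coprime (ν : ℂ) {a b : ℕ} (h : a.Coprime b) :
    dsigma ν ((a * b : ℕ) : ℤ) = dsigma ν a * dsigma ν b := by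
  let f : ArithmeticFunction ℂ := ⟨fun k => if k = 0 then 0 else (k : ℂ) ^ ν, by simp⟩
  have hf : f.IsMultiplicative := by
    rw [ArithmeticFunction.IsMultiplicative.iff_ne_zero]
    refine ⟨by simp [f], fun {m k} hm hk _ => ?_⟩
    simp [f, hm, hk, Complex.natCast_mul_natCast_cpow]
  have key : ∀ k : ℕ, dsigma ν k = (f * (ArithmeticFunction.zeta : ArithmeticFunction ℂ)) k := by
    intro k
    rw [ArithmeticFunction.coe_mul_zeta_apply, dsigma, Int.natAbs_natCast]
    refine Finset.sum_congr rfl fun d hd => ?_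
    simp [f, (Nat.pos_of_mem_divisors hd).ne']
  rw [key, key, key]
  exact (hf.mul ArithmeticFunction.isMultiplicative_zeta.natCast).map_mul_of_coprime h

lemma dsigma_mul_of_coprime (ν : ℂ) {a b : ℤ} (h : IsCoprime a b) :
    dsigma ν (a * b) = dsigma ν a * dsigma ν b := by
  have := dsigma_natCast_mul_of_coprime ν
    (Int.isCoprime_iff_gcd_eq_one.mp h : a.natAbs.Coprime b.natAbs)
  simpa only [dsigma, Int.natAbs_mul, Int.natAbs_natCast] using this

lemma dsigma_prime_pow (ν : ℂ) {p : ℕ} (hp : p.Prime) (v : ℕ) :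
    dsigma ν ((p : ℤ) ^ v) = ∑ i ∈ Finset.range (v + 1), ((p : ℂ) ^ ν) ^ i := by
  rw [dsigma, Int.natAbs_pow, Int.natAbs_natCast, Nat.sum_divisors_prime_pow hp]
  refine Finset.sum_congr rfl fun i _ => ?_
  rw [Nat.cast_pow, ← Complex.natCast_cpow_natCast_mul, ← Complex.cpow_nat_mul]

/-- The convolution rule for truncated geometric sums. -/
lemma geom_range_mul (y : ℂ) (v a : ℕ) :
    (∑ i ∈ Finset.range (v + 1), y ^ i) * ∑ i ∈ Finset.range (a + 1), y ^ i =
      ∑ i ∈ Finset.range (v + a + 1), y ^ i +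
        y * (∑ i ∈ Finset.range v, y ^ i) * ∑ i ∈ Finset.range a, y ^ i := by
  have h1 : ∑ i ∈ Finset.range (v + a + 1), y ^ i =
      ∑ i ∈ Finset.range (v + 1), y ^ i + y ^ (v + 1) * ∑ i ∈ Finset.range a, y ^ i := by
    rw [show v + a + 1 = (v + 1) + a by ring, Finset.sum_range_add, Finset.mul_sum]
    simp only [pow_add]
  have h2 : ∑ i ∈ Finset.range (a + 1), y ^ i = 1 + y * ∑ i ∈ Finset.range a, y ^ i := by
    rw [Finset.sum_range_succ', Finset.mul_sum]
    simp only [pow_succ', pow_zero, add_comm]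
  rw [h1, h2, Finset.sum_range_succ]
  ring

/-- The Hecke relation for the divisor function. -/
lemma dsigma_prime_pow_mul (ν : ℂ) {p : ℕ} (hp : p.Prime) (v : ℕ) (m : ℤ) :
    dsigma ν ((p : ℤ) ^ v * (p * m)) =
      (∑ i ∈ Finset.range (v + 1), ((p : ℂ) ^ ν) ^ i) * dsigma ν (p * m) -
        (p : ℂ) ^ ν * (∑ i ∈ Finset.range v, ((p : ℂ) ^ ν) ^ i) * dsigma ν m := by
  rcases eq_or_ne m 0 with rfl | hm
  · simp [dsigma_zero]
  have hpz : Prime (p : ℤ) := Nat.prime_iff_prime_int.mp hp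
  obtain ⟨a, k, hk, rfl⟩ : ∃ a k, ¬ (p : ℤ) ∣ k ∧ m = (p : ℤ) ^ a * k :=
    (FiniteMultiplicity.of_prime_left hpz hm).exists_eq_pow_mul_and_not_dvd.elim
      fun k hk => ⟨_, k, hk.2, hk.1⟩
  have hc : ∀ e : ℕ, dsigma ν ((p : ℤ) ^ e * k) =
      (∑ i ∈ Finset.range (e + 1), ((p : ℂ) ^ ν) ^ i) * dsigma ν k := fun e => by
    rw [dsigma_mul_of_coprime ν ((hpz.coprime_iff_not_dvd.mpr hk).pow_left), dsigma_prime_pow ν hp]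
  rw [← mul_assoc (p : ℤ), ← pow_succ', ← mul_assoc, ← pow_add, hc, hc, hc, ← mul_assoc,
    geom_range_mul]
  ring

/-- Expansion of the divisor function as a sum over all natural numbers. -/
lemma hasSum_dsigma_mul (ν : ℂ) {k : ℤ} (hk : k ≠ 0) (w : ℂ) :
    HasSum (fun e : ℕ => if 0 < e ∧ (e : ℤ) ∣ k then (e : ℂ) ^ ν * w else 0) (dsigma ν k * w) := by
  have hmem : ∀ e : ℕ, e ∈ k.natAbs.divisors ↔ 0 < e ∧ (e : ℤ) ∣ k := fun e => by
    rw [Nat.mem_divisors, Int.natCast_dvd]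
    exact ⟨fun h => ⟨Nat.pos_of_dvd_of_pos h.1 (Int.natAbs_pos.mpr hk), h.1⟩,
      fun h => ⟨h.2, Int.natAbs_ne_zero.mpr hk⟩⟩
  have hsum : dsigma ν k * w = ∑ e ∈ k.natAbs.divisors,
      if 0 < e ∧ (e : ℤ) ∣ k then (e : ℂ) ^ ν * w else 0 := by
    rw [dsigma, Finset.sum_mul]
    exact Finset.sum_congr rfl fun e he => (if_pos ((hmem e).mp he)).symm
  rw [hsum]
  exact hasSum_sum_of_ne_finset_zero fun e he => if_neg ((hmem e).not.mp he)

lemma summable_norm_intCast_zpow {P : ℤ} (hP : P ≤ -2) :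
    Summable (fun f : ℤ => ‖(f : ℂ) ^ P‖) := by
  have hb : (1 : ℝ) < ((-P : ℤ) : ℝ) := by exact_mod_cast (by omega : (1 : ℤ) < -P)
  refine (Real.summable_abs_int_rpow hb).congr fun f => ?_
  rw [norm_zpow, Complex.norm_intCast, ← Real.rpow_intCast]
  push_cast
  rw [neg_neg]

lemma summable_norm_natCast_cpow {ν : ℂ} (hν : ν.re < -1) :
    Summable (fun d : ℕ => ‖(d : ℂ) ^ ν‖) := by
  have hne : ν.re ≠ 0 := by linarith
  refine (Real.summable_nat_rpow.mpr hν).congr fun d => ?_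
  rw [Complex.norm_natCast_cpow_of_re_ne_zero _ hne]

lemma summable_divisor_kernel {r : ℝ} {P : ℤ} (hP : (P : ℝ) ≤ -3 - |r|) {χ : ℤ → ℂ}
    (hχ : ∀ k, ‖χ k‖ ≤ 1) :
    Summable (fun x : ℤ × ℕ => if 0 < x.2 ∧ (x.2 : ℤ) ∣ x.1 then
      (x.2 : ℂ) ^ (r : ℂ) * ((x.1 : ℂ) ^ P * χ x.1) else 0) := by
  have h1 : Summable (fun k : ℤ => |(k : ℝ)| ^ (-(3 / 2) : ℝ)) :=
    Real.summable_abs_int_rpow (by norm_num)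
  have h2 : Summable (fun e : ℕ => (e : ℝ) ^ (-(3 / 2) : ℝ)) :=
    Real.summable_nat_rpow.mpr (by norm_num)
  have hP0 : P ≠ 0 := by
    rintro rfl
    have := abs_nonneg r
    norm_num at hP
    linarith
  refine Summable.of_norm_bounded (h1.mul_of_nonneg h2 (fun k => by positivity)
    (fun e => by positivity)) ?_
  rintro ⟨k, e⟩
  dsimp only
  split_ifs with h
  · rcases eq_or_ne k 0 with rfl | hk
    · simp only [Int.cast_zero, zero_zpow P hP0, zero_mul, mul_zero, norm_zero]
      positivity
    have he : (1 : ℝ) ≤ e := by exact_mod_cast h.1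
    have hek : (e : ℝ) ≤ |(k : ℝ)| := by
      have := Int.le_of_dvd (abs_pos.mpr hk) ((dvd_abs _ _).mpr h.2)
      exact_mod_cast this
    have hk1 : (1 : ℝ) ≤ |(k : ℝ)| := he.trans hek
    have hk0 : 0 < |(k : ℝ)| := by linarith
    rw [norm_mul, norm_mul, Complex.norm_natCast_cpow_of_pos h.1, Complex.ofReal_re, norm_zpow,
      Complex.norm_intCast]
    calc (e : ℝ) ^ r * (|(k : ℝ)| ^ P * ‖χ k‖)
        ≤ |(k : ℝ)| ^ |r| * (|(k : ℝ)| ^ P * 1) := by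
          gcongr
          · exact (Real.rpow_le_rpow_of_exponent_le he (le_abs_self r)).trans
              (Real.rpow_le_rpow (by linarith) hek (abs_nonneg r))
          · exact hχ k
      _ = |(k : ℝ)| ^ (|r| + P) := by
          rw [mul_one, Real.rpow_add hk0, Real.rpow_intCast]
      _ ≤ |(k : ℝ)| ^ (-(3 / 2) + -(3 / 2) : ℝ) :=
          Real.rpow_le_rpow_of_exponent_le hk1 (by linarith)
      _ = |(k : ℝ)| ^ (-(3 / 2) : ℝ) * |(k : ℝ)| ^ (-(3 / 2) : ℝ) := Real.rpow_add hk0 _ _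
      _ ≤ |(k : ℝ)| ^ (-(3 / 2) : ℝ) * (e : ℝ) ^ (-(3 / 2) : ℝ) := by
          gcongr ?_ * ?_
          exact Real.rpow_le_rpow_of_nonpos (by linarith) hek (by norm_num)
  · rw [norm_zero]
    positivity

lemma tsum_multiples {w : ℤ → ℂ} {e : ℤ} (he : e ≠ 0) :
    ∑' k : ℤ, (if e ∣ k then w k else 0) = ∑' f : ℤ, w (e * f) := by
  rw [← (mul_right_injective₀ he).tsum_eq (f := fun k : ℤ => if e ∣ k then w k else 0)]
  · simp
  · intro k hk
    obtain ⟨f, rfl⟩ : e ∣ k := by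
      by_contra h
      simp [h] at hk
    exact ⟨f, rfl⟩

lemma le_neg_three_of_le {r : ℝ} {P : ℤ} (hP : (P : ℝ) ≤ -3 - |r|) : P ≤ -3 := by
  have := abs_nonneg r
  exact_mod_cast (by linarith : (P : ℝ) ≤ -3)

lemma tsum_divisor_kernel (r : ℝ) {P : ℤ} (hP0 : P ≠ 0) (χ : ℤ → ℂ) (k : ℤ) :
    ∑' e : ℕ, (if 0 < e ∧ (e : ℤ) ∣ k then (e : ℂ) ^ (r : ℂ) * ((k : ℂ) ^ P * χ k) else 0) =
      dsigma r k * (k : ℂ) ^ P * χ k := by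
  rcases eq_or_ne k 0 with rfl | hk
  · simp [zero_zpow P hP0]
  · rw [(hasSum_dsigma_mul _ hk _).tsum_eq, mul_assoc]

lemma summable_dsigma_mul_zpow {r : ℝ} {P : ℤ} (hP : (P : ℝ) ≤ -3 - |r|) :
    Summable (fun k : ℤ => ‖dsigma r k * (k : ℂ) ^ P‖) := by
  have hP3 := le_neg_three_of_le hP
  have := (summable_divisor_kernel hP (χ := fun _ => 1) (by simp)).prod
  have h := this.congr fun k => tsum_divisor_kernel r (by omega : P ≠ 0) (fun _ => 1) k
  simpa only [mul_one] using h.norm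

lemma hasSum_dsigma_mul_zpow {r : ℝ} {P : ℤ} (hP : (P : ℝ) ≤ -3 - |r|) {χ : ℤ → ℂ}
    (hχ : ∀ k, ‖χ k‖ ≤ 1) :
    HasSum (fun e : ℕ => (e : ℂ) ^ (r : ℂ) * (e : ℂ) ^ P * ∑' f : ℤ, (f : ℂ) ^ P * χ (e * f))
      (∑' k : ℤ, dsigma r k * (k : ℂ) ^ P * χ k) := by
  have hP3 := le_neg_three_of_le hP
  have hs := summable_divisor_kernel hP hχ
  have hinner : ∀ e : ℕ, ∑' k : ℤ, (if 0 < e ∧ (e : ℤ) ∣ k then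
      (e : ℂ) ^ (r : ℂ) * ((k : ℂ) ^ P * χ k) else 0) =
      (e : ℂ) ^ (r : ℂ) * (e : ℂ) ^ P * ∑' f : ℤ, (f : ℂ) ^ P * χ (e * f) := by
    intro e
    rcases Nat.eq_zero_or_pos e with rfl | he
    · simp [zero_zpow P (by omega)]
    · simp only [he, true_and]
      rw [tsum_multiples (by exact_mod_cast he.ne'), ← tsum_mul_left]
      refine tsum_congr fun f => ?_
      push_cast
      rw [mul_zpow]
      ring
  have hs2 := hs.prod_symm.prod.congr hinner
  have hcomm := Summable.tsum_comm (f := fun (k : ℤ) (e : ℕ) =>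
    if 0 < e ∧ (e : ℤ) ∣ k then (e : ℂ) ^ (r : ℂ) * ((k : ℂ) ^ P * χ k) else 0) hs
  have heq := (tsum_congr hinner).symm.trans
    (hcomm.trans (tsum_congr (tsum_divisor_kernel r (by omega) χ)))
  exact heq ▸ hs2.hasSum

lemma tsum_intCast_zpow {P : ℤ} (hP : P ≤ -3) :
    ∑' f : ℤ, (f : ℂ) ^ P = 2 * (if 2 ∣ P then (1 : ℂ) else 0) * riemannZeta (-(P : ℂ)) := by
  obtain ⟨k, rfl⟩ : ∃ k : ℕ, P = -(k : ℤ) := ⟨(-P).toNat, by omega⟩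
  split_ifs with h
  · have hk : Even k := by
      rw [even_iff_two_dvd]
      omega
    push_cast
    rw [neg_neg, mul_one, two_mul_riemannZeta_eq_tsum_int_inv_pow_of_even (by omega) hk]
    simp
  · have hk : Odd (-(k : ℤ)) := by
      rw [← Int.not_even_iff_odd, even_iff_two_dvd]
      exact h
    have h1 : ∑' f : ℤ, (f : ℂ) ^ (-(k : ℤ)) = -∑' f : ℤ, (f : ℂ) ^ (-(k : ℤ)) := by
      rw [← tsum_neg]
      conv_lhs => rw [← (Equiv.neg ℤ).tsum_eq]
      refine tsum_congr fun f => ?_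
      rw [Equiv.neg_apply, Int.cast_neg, hk.neg_zpow]
    rw [mul_zero, zero_mul]
    exact self_eq_neg.mp h1

lemma natCast_cpow_mul_zpow {e : ℕ} (he : e ≠ 0) (ν : ℂ) (P : ℤ) :
    (e : ℂ) ^ ν * (e : ℂ) ^ P = 1 / (e : ℂ) ^ (-ν - P) := by
  have he' : (e : ℂ) ≠ 0 := by exact_mod_cast he
  rw [← Complex.cpow_intCast, ← Complex.cpow_add _ _ he', one_div, ← Complex.cpow_neg]
  ring_nf

lemma one_lt_re_of_le {r : ℝ} {P : ℤ} (hP : (P : ℝ) ≤ -3 - |r|) :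
    1 < (-(r : ℂ) - (P : ℂ)).re := by
  have := le_abs_self r
  simp
  linarith

lemma tsum_dsigma_mul_zpow {r : ℝ} {P : ℤ} (hP : (P : ℝ) ≤ -3 - |r|) :
    ∑' k : ℤ, dsigma r k * (k : ℂ) ^ P =
      riemannZeta (-(r : ℂ) - (P : ℂ)) * ∑' f : ℤ, (f : ℂ) ^ P := by
  have hP3 := le_neg_three_of_le hP
  have h := (hasSum_dsigma_mul_zpow hP (χ := fun _ => 1) (by simp)).tsum_eq
  simp only [mul_one] at h
  rw [← h, tsum_mul_right, zeta_eq_tsum_one_div_nat_cpow (one_lt_re_of_le hP)]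
  congr 1
  refine tsum_congr fun e => ?_
  rcases eq_or_ne e 0 with rfl | he
  · have : -(r : ℂ) - (P : ℂ) ≠ 0 := fun h0 => by
      have := one_lt_re_of_le hP
      rw [h0] at this
      norm_num at this
    simp [zero_zpow P (by omega), Complex.zero_cpow this]
  · exact natCast_cpow_mul_zpow he _ _

lemma summable_dsigma_mul_left {r : ℝ} {P : ℤ} (hP : (P : ℝ) ≤ -3 - |r|) {d : ℕ} (hd : d ≠ 0) :
    Summable (fun k : ℤ => dsigma r (d * k) * (k : ℂ) ^ P) := by
  have hd' : (d : ℂ) ^ P ≠ 0 := zpow_ne_zero _ (by exact_mod_cast hd)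
  have := (summable_dsigma_mul_zpow hP).of_norm.comp_injective
    (mul_right_injective₀ (by exact_mod_cast hd : (d : ℤ) ≠ 0))
  refine (this.mul_left ((d : ℂ) ^ P)⁻¹).congr fun k => ?_
  simp only [Function.comp, Int.cast_mul, Int.cast_natCast, mul_zpow]
  field_simp

lemma tsum_dsigma_prime_pow_mul {r : ℝ} {P : ℤ} (hP : (P : ℝ) ≤ -3 - |r|) {p d v : ℕ}
    (hp : p.Prime) (hd : ¬ p ∣ d) :
    ∑' k : ℤ, dsigma r ((p ^ v * d : ℕ) * k) * (k : ℂ) ^ P =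
      (1 + (1 - (p : ℂ) ^ P) * ∑ j ∈ Finset.Icc 1 v, (p : ℂ) ^ ((j : ℂ) * (r : ℂ))) *
        ∑' k : ℤ, dsigma r (d * k) * (k : ℂ) ^ P := by
  have hd0 : d ≠ 0 := by
    rintro rfl
    simp at hd
  have hpz : Prime (p : ℤ) := Nat.prime_iff_prime_int.mp hp
  have hdz : ¬ (p : ℤ) ∣ d := by rwa [Int.natCast_dvd_natCast]
  set y : ℂ := (p : ℂ) ^ (r : ℂ) with hy
  set S : ℕ → ℂ := fun m => ∑ i ∈ Finset.range m, y ^ i with hS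
  have hterm : ∀ k : ℤ, (if (p : ℤ) ∣ k then
      y * S v * dsigma r (d * (k / p)) * (k : ℂ) ^ P else 0) =
      S (v + 1) * (dsigma r (d * k) * (k : ℂ) ^ P) -
        dsigma r ((p ^ v * d : ℕ) * k) * (k : ℂ) ^ P := by
    intro k
    push_cast
    split_ifs with hk
    · obtain ⟨k, rfl⟩ := hk
      rw [Int.mul_ediv_cancel_left _ hpz.ne_zero,
        show (p : ℤ) ^ v * d * (p * k) = (p : ℤ) ^ v * (p * (d * k)) by ring,
        dsigma_prime_pow_mul _ hp, show (d : ℤ) * (p * k) = p * (d * k) by ring]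
      ring
    · have : IsCoprime ((p : ℤ) ^ v) (d * k) :=
        (hpz.coprime_iff_not_dvd.mpr (hpz.dvd_mul.not.mpr (by tauto))).pow_left
      rw [mul_assoc ((p : ℤ) ^ v), dsigma_mul_of_coprime _ this, dsigma_prime_pow _ hp]
      ring
  have hsum : y * S v * (p : ℂ) ^ P * ∑' k : ℤ, dsigma r (d * k) * (k : ℂ) ^ P =
      S (v + 1) * ∑' k : ℤ, dsigma r (d * k) * (k : ℂ) ^ P -
        ∑' k : ℤ, dsigma r ((p ^ v * d : ℕ) * k) * (k : ℂ) ^ P := by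
    rw [← tsum_mul_left (a := S (v + 1)), ← Summable.tsum_sub
      ((summable_dsigma_mul_left hP hd0).mul_left _)
      (summable_dsigma_mul_left hP (mul_ne_zero (pow_ne_zero _ hp.ne_zero) hd0)),
      ← tsum_congr hterm, tsum_multiples hpz.ne_zero, ← tsum_mul_left]
    refine tsum_congr fun k => ?_
    rw [Int.mul_ediv_cancel_left _ hpz.ne_zero]
    push_cast
    rw [mul_zpow]
    ring
  have hIcc : ∑ j ∈ Finset.Icc 1 v, (p : ℂ) ^ ((j : ℂ) * (r : ℂ)) = y * S v := by
    simp only [hS]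
    rw [Finset.mul_sum, ← Finset.Ico_add_one_right_eq_Icc, Finset.sum_Ico_eq_sum_range]
    refine Finset.sum_congr rfl fun i _ => ?_
    rw [Complex.cpow_nat_mul, ← hy, add_comm, pow_succ']
  have hSucc : S (v + 1) = 1 + y * S v := by
    simp only [hS]
    rw [Finset.sum_range_succ', Finset.mul_sum]
    simp only [pow_succ', pow_zero, add_comm]
  rw [hIcc]
  linear_combination hsum + (∑' k : ℤ, dsigma r (d * k) * (k : ℂ) ^ P) * hSucc

lemma tsum_dsigma_mul_left {r : ℝ} {P : ℤ} (hP : (P : ℝ) ≤ -3 - |r|) {d : ℕ} (hd : d ≠ 0) :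
    ∑' k : ℤ, dsigma r (d * k) * (k : ℂ) ^ P =
      (∏ p ∈ d.primeFactors, (1 + (1 - (p : ℂ) ^ P) *
        ∑ j ∈ Finset.Icc 1 (d.factorization p), (p : ℂ) ^ ((j : ℂ) * (r : ℂ)))) *
        (riemannZeta (-(r : ℂ) - (P : ℂ)) * ∑' f : ℤ, (f : ℂ) ^ P) := by
  induction d using Nat.recOnPrimePow with
  | zero => exact absurd rfl hd
  | one => simp [tsum_dsigma_mul_zpow hP]
  | prime_pow_mul a p v hp hpa hv ih =>
    have ha : a ≠ 0 := right_ne_zero_of_mul hd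
    have hcop : (p ^ v).Coprime a := ((Nat.Prime.coprime_iff_not_dvd hp).mpr hpa).pow_left v
    have hnot : p ∉ a.primeFactors := fun h => hpa (Nat.dvd_of_mem_primeFactors h)
    rw [tsum_dsigma_prime_pow_mul hP hp hpa, ih ha, hcop.primeFactors_mul,
      Nat.primeFactors_prime_pow hv.ne' hp, ← Finset.insert_eq, Finset.prod_insert hnot, mul_assoc]
    have hself : (p ^ v * a).factorization p = v := by
      rw [Nat.factorization_mul (pow_ne_zero _ hp.ne_zero) ha]
      simp [hp.factorization_self, Nat.factorization_eq_zero_of_not_dvd hpa]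
    rw [hself]
    congr 2
    refine Finset.prod_congr rfl fun q hq => ?_
    have hqp : q ≠ p := fun h => hnot (h ▸ hq)
    have : (p ^ v * a).factorization q = a.factorization q := by
      rw [Nat.factorization_mul (pow_ne_zero _ hp.ne_zero) ha]
      simp [hp.factorization, hqp.symm]
    rw [this]

lemma tsum_residue_class {r : ℝ} {P : ℤ} (hP : (P : ℝ) ≤ -3 - |r|) {c d : ℕ}
    (hc : c ∈ Finset.Icc 1 d) :
    ∑' q : ℕ, ((c + d * q : ℕ) : ℂ) ^ (r : ℂ) * ((c + d * q : ℕ) : ℂ) ^ P =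
      (d : ℂ) ^ (r : ℂ) * (d : ℂ) ^ P * hzeta (-(r : ℂ) - (P : ℂ)) ((c : ℝ) / d) := by
  obtain ⟨hc1, hcd⟩ := Finset.mem_Icc.mp hc
  have hd : (0 : ℝ) < d := by exact_mod_cast (by omega : 0 < d)
  have hmem : (c : ℝ) / d ∈ Set.Icc (0 : ℝ) 1 :=
    ⟨by positivity, (div_le_one hd).mpr (by exact_mod_cast hcd)⟩
  rw [hzeta, ← (HurwitzZeta.hasSum_hurwitzZeta_of_one_lt_re hmem (one_lt_re_of_le hP)).tsum_eq,
    ← tsum_mul_left]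
  refine tsum_congr fun q => ?_
  have hmul : ((c + d * q : ℕ) : ℂ) = ((d : ℝ) : ℂ) * ((q + (c : ℝ) / d : ℝ) : ℂ) := by
    rw [← Complex.ofReal_mul]
    have : (d : ℝ) * (q + (c : ℝ) / d) = ((c + d * q : ℕ) : ℝ) := by
      push_cast
      field_simp
      ring
    rw [this, Complex.ofReal_natCast]
  rw [natCast_cpow_mul_zpow (by omega : c + d * q ≠ 0), natCast_cpow_mul_zpow (by omega : d ≠ 0),
    hmul, Complex.mul_cpow_ofReal_nonneg hd.le (by positivity)]
  push_cast
  rw [one_div_mul_one_div]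

lemma tsum_periodic {r : ℝ} {P : ℤ} (hP : (P : ℝ) ≤ -3 - |r|) {d : ℕ} (hd : 0 < d) {A : ℕ → ℂ}
    (hA : ∀ c q, A (c + d * q) = A c)
    (hs : Summable (fun e : ℕ => (e : ℂ) ^ (r : ℂ) * (e : ℂ) ^ P * A e)) :
    ∑' e : ℕ, (e : ℂ) ^ (r : ℂ) * (e : ℂ) ^ P * A e =
      (d : ℂ) ^ (r : ℂ) * (d : ℂ) ^ P *
        ∑ c ∈ Finset.Icc 1 d, hzeta (-(r : ℂ) - (P : ℂ)) ((c : ℝ) / d) * A c := by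
  have hP3 := le_neg_three_of_le hP
  obtain ⟨d, rfl⟩ := Nat.exists_eq_add_one.mpr hd
  set g : ℕ → ℂ := fun e => (e : ℂ) ^ (r : ℂ) * (e : ℂ) ^ P * A e with hg
  have h0 : g 0 = 0 := by simp [hg, zero_zpow P (by omega)]
  have hres : ∑' e, g (e + 1) = ∑ i ∈ Finset.range (d + 1), ∑' q, g (i + (d + 1) * q + 1) :=
    (Nat.sumByResidueClasses ((summable_nat_add_iff 1).mpr hs) (d + 1)).trans
      (Fin.sum_univ_eq_sum_range (fun i => ∑' q, g (i + (d + 1) * q + 1)) (d + 1))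
  rw [hs.tsum_eq_zero_add, h0, zero_add, hres, Finset.mul_sum,
    ← Finset.Ico_add_one_right_eq_Icc, Finset.sum_Ico_eq_sum_range]
  refine Finset.sum_congr rfl fun i hi => ?_
  have hi' := Finset.mem_range.mp hi
  have hmem : 1 + i ∈ Finset.Icc 1 (d + 1) := Finset.mem_Icc.mpr ⟨by omega, by omega⟩
  rw [← mul_assoc, ← tsum_residue_class hP hmem, ← tsum_mul_right]
  refine tsum_congr fun q => ?_
  rw [show i + (d + 1) * q + 1 = 1 + i + (d + 1) * q by ring]
  simp only [hg, hA]

/-- The solutions of `c * f ≡ n` modulo `d` in terms of one element of `B_{c,d}`. -/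
lemma dvd_sub_mul_iff {n b : ℤ} {c d : ℕ} (hd : 0 < d) (hb : ∃ a : ℤ, a * d - b * c = n) (f : ℤ) :
    (d : ℤ) ∣ n - c * f ↔ ∃ m : ℤ, -(b + (d / Nat.gcd c d : ℕ) * m) = f := by
  obtain ⟨a, rfl⟩ := hb
  have hg : 0 < Nat.gcd c d := Nat.gcd_pos_of_pos_right _ hd
  obtain ⟨g, c', d', hg', hcop, rfl, rfl⟩ := Nat.exists_coprime' hg
  have hg0 : (g : ℤ) ≠ 0 := by exact_mod_cast hg'.ne'
  rw [Nat.gcd_mul_right, hcop.gcd_eq_one, one_mul, Nat.mul_div_cancel _ hg']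
  push_cast
  rw [show a * (d' * g) - b * (c' * g) - c' * g * f = a * (d' * g) - (c' * (b + f)) * g by ring,
    dvd_sub_right (Dvd.intro_left _ rfl), mul_dvd_mul_iff_right hg0]
  have hcop' : IsCoprime (d' : ℤ) (c' : ℤ) := Nat.isCoprime_iff_coprime.mpr hcop.symm
  constructor
  · intro h
    obtain ⟨m, hm⟩ := hcop'.dvd_of_dvd_mul_left h
    exact ⟨-m, by linear_combination -hm⟩
  · rintro ⟨m, rfl⟩
    exact Dvd.intro (-(c' * m)) (by ring)

lemma neg_add_mul_eq_uval {c d : ℕ} (hd : 0 < d) (b m : ℤ) :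
    ((-(b + (d / Nat.gcd c d : ℕ) * m) : ℤ) : ℝ) =
      -1 * ((d : ℝ) * ((Nat.gcd c d : ℕ) : ℝ)⁻¹) * (m + uval c d b) := by
  have hg : ((Nat.gcd c d : ℕ) : ℝ) ≠ 0 := by
    exact_mod_cast (Nat.gcd_pos_of_pos_right _ hd).ne'
  have hd' : (d : ℝ) ≠ 0 := by exact_mod_cast hd.ne'
  rw [Int.cast_neg, Int.cast_add, Int.cast_mul, Int.cast_natCast,
    Nat.cast_div (Nat.gcd_dvd_right c d) hg, uval]
  push_cast
  field_simp
  ring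

lemma neg_add_mul_injective {c d : ℕ} (hd : 0 < d) (b : ℤ) :
    Function.Injective (fun m : ℤ => -(b + (d / Nat.gcd c d : ℕ) * m)) := by
  have : ((d / Nat.gcd c d : ℕ) : ℤ) ≠ 0 := by
    exact_mod_cast (Nat.div_pos (Nat.gcd_le_right _ hd) (Nat.gcd_pos_of_pos_right _ hd)).ne'
  intro m m' h
  exact mul_left_cancel₀ this (add_left_cancel (neg_injective h))

lemma summable_add_uval_zpow {P : ℤ} (hP : P ≤ -3) {c d : ℕ} (hd : 0 < d) (b : ℤ) :
    Summable (fun m : ℤ => ((m : ℝ) + uval c d b) ^ P) := by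
  have hg : ((Nat.gcd c d : ℕ) : ℝ) ≠ 0 := by
    exact_mod_cast (Nat.gcd_pos_of_pos_right _ hd).ne'
  have hd' : (d : ℝ) ≠ 0 := by exact_mod_cast hd.ne'
  have hne : (-1 * ((d : ℝ) * ((Nat.gcd c d : ℕ) : ℝ)⁻¹)) ^ P ≠ 0 :=
    zpow_ne_zero _ (by simp [hg, hd'])
  have h1 : Summable (fun f : ℤ => (f : ℝ) ^ P) := by
    refine Summable.of_norm ((summable_norm_intCast_zpow (by omega : P ≤ -2)).congr fun f => ?_)
    rw [norm_zpow, norm_zpow, Complex.norm_intCast, Real.norm_eq_abs]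
  refine ((h1.comp_injective (neg_add_mul_injective (c := c) hd b)).mul_left
    ((-1 * ((d : ℝ) * ((Nat.gcd c d : ℕ) : ℝ)⁻¹)) ^ P)⁻¹).congr fun m => ?_
  simp only [Function.comp]
  rw [neg_add_mul_eq_uval hd, mul_zpow _ ((m : ℝ) + _), inv_mul_cancel_left₀ hne]

lemma tsum_zpow_mul_ite_dvd {n b : ℤ} (P : ℤ) {c d : ℕ} (hd : 0 < d)
    (hb : (Nat.gcd c d : ℤ) ∣ n → ∃ a : ℤ, a * d - b * c = n) :
    ∑' f : ℤ, (f : ℂ) ^ P * (if (d : ℤ) ∣ n - c * f then 1 else 0) =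
      (-1 : ℂ) ^ P * (d : ℂ) ^ P * (if (Nat.gcd c d : ℤ) ∣ n then
        (Nat.gcd c d : ℂ) ^ (-P) * ((∑' m : ℤ, ((m : ℝ) + uval c d b) ^ P : ℝ) : ℂ) else 0) := by
  split_ifs with hg
  · rw [← (neg_add_mul_injective (c := c) hd b).tsum_eq]
    · rw [Complex.ofReal_tsum, ← tsum_mul_left, ← tsum_mul_left]
      refine tsum_congr fun m => ?_
      rw [if_pos ((dvd_sub_mul_iff hd (hb hg) _).mpr ⟨m, rfl⟩), mul_one, ← Complex.ofReal_intCast,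
        neg_add_mul_eq_uval hd]
      push_cast
      rw [mul_zpow, mul_zpow, mul_zpow, inv_zpow', mul_assoc, mul_assoc, mul_assoc]
    · intro f hf
      refine (dvd_sub_mul_iff hd (hb hg) f).mp ?_
      by_contra h
      simp [h] at hf
  · have : ∀ f : ℤ, ¬ (d : ℤ) ∣ n - c * f := fun f h => hg <| by
      have h1 : (Nat.gcd c d : ℤ) ∣ n - c * f :=
        (Int.natCast_dvd_natCast.mpr (Nat.gcd_dvd_right c d)).trans h
      exact (dvd_sub_left ((Int.natCast_dvd_natCast.mpr (Nat.gcd_dvd_left c d)).mul_right f)).mp h1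
    simp [this]

lemma tsum_dsigma_residue {r : ℝ} {P : ℤ} (hP : (P : ℝ) ≤ -3 - |r|) (n : ℤ) {d : ℕ} (hd : 0 < d)
    {bstar : ℕ → ℕ → ℤ}
    (hb : ∀ c ∈ Finset.Icc 1 d, (Nat.gcd c d : ℤ) ∣ n → ∃ a : ℤ, a * d - bstar c d * c = n)
    (r₁ : ℂ) :
    (d : ℂ) ^ r₁ * ∑' k : ℤ, dsigma r k * (k : ℂ) ^ P * (if (d : ℤ) ∣ n - k then 1 else 0) =
      (-1 : ℂ) ^ P * ((d : ℂ) ^ (r₁ + (r : ℂ) + 2 * (P : ℂ)) *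
        ∑ c ∈ Finset.Icc 1 d, (if (Nat.gcd c d : ℤ) ∣ n then
          (Nat.gcd c d : ℂ) ^ (-P) * hzeta (-(r : ℂ) - (P : ℂ)) ((c : ℝ) / d) *
            ((∑' m : ℤ, ((m : ℝ) + uval c d (bstar c d)) ^ P : ℝ) : ℂ) else 0)) := by
  have hd' : (d : ℂ) ≠ 0 := by exact_mod_cast hd.ne'
  have hs := hasSum_dsigma_mul_zpow hP (χ := fun k => if (d : ℤ) ∣ n - k then 1 else 0)
    (fun k => by split_ifs <;> simp)
  have hper : ∀ c q : ℕ, ∑' f : ℤ, (f : ℂ) ^ P *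
      (if (d : ℤ) ∣ n - ((c + d * q : ℕ) : ℤ) * f then 1 else 0) =
      ∑' f : ℤ, (f : ℂ) ^ P * (if (d : ℤ) ∣ n - (c : ℤ) * f then 1 else 0) := by
    intro c q
    refine tsum_congr fun f => ?_
    have : n - ((c + d * q : ℕ) : ℤ) * f = n - c * f - d * (q * f) := by
      push_cast
      ring
    rw [this]
    simp only [dvd_sub_left (Dvd.intro (α := ℤ) _ rfl)]
  rw [← hs.tsum_eq, tsum_periodic hP hd hper hs.summable]
  have hpow : (d : ℂ) ^ (r₁ + (r : ℂ) + 2 * (P : ℂ)) =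
      (d : ℂ) ^ r₁ * (d : ℂ) ^ (r : ℂ) * ((d : ℂ) ^ P * (d : ℂ) ^ P) := by
    rw [Complex.cpow_add _ _ hd', Complex.cpow_add _ _ hd', two_mul, Complex.cpow_add _ _ hd',
      Complex.cpow_intCast]
  rw [hpow]
  simp only [Finset.mul_sum]
  refine Finset.sum_congr rfl fun c hc => ?_
  rw [tsum_zpow_mul_ite_dvd P hd (hb c hc)]
  split_ifs <;> ring

lemma tsum_dsigma_of_dvd {r : ℝ} {P : ℤ} {n : ℤ} {d : ℕ} (hd : 0 < d) (hdn : (d : ℤ) ∣ n) :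
    ∑' k : ℤ, dsigma r k * (k : ℂ) ^ P * (if (d : ℤ) ∣ n - k then 1 else 0) =
      (d : ℂ) ^ P * ∑' k : ℤ, dsigma r (d * k) * (k : ℂ) ^ P := by
  have hd0 : (d : ℤ) ≠ 0 := by exact_mod_cast hd.ne'
  simp only [dvd_sub_right hdn, mul_ite, mul_one, mul_zero]
  rw [tsum_multiples hd0, ← tsum_mul_left]
  refine tsum_congr fun k => ?_
  push_cast
  rw [mul_zpow]
  ring

/-- Expanding `σ_{r₁}` and exchanging sums, where `m = 0` contributes `ζ(-r₁)`. -/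
lemma summable_and_hasSum_dsigma_mul {r₁ : ℂ} (hr₁ : r₁.re < -1) (n : ℤ) {W : ℤ → ℂ}
    (hW : Summable (fun k => ‖W k‖)) :
    Summable (fun m : ℤ => dsigma r₁ m * W (n - m)) ∧
    HasSum (fun d : ℕ => if 0 < d then
        (d : ℂ) ^ r₁ * ∑' k : ℤ, W k * (if (d : ℤ) ∣ n - k then 1 else 0) else 0)
      (∑' m : ℤ, dsigma r₁ m * W (n - m) + riemannZeta (-r₁) * W n) := by
  have hW' : Summable (fun m => ‖W (n - m)‖) := hW.comp_injective (Equiv.subLeft n).injective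
  have hs : Summable (fun x : ℤ × ℕ => if 0 < x.2 ∧ (x.2 : ℤ) ∣ x.1 then
      (x.2 : ℂ) ^ r₁ * W (n - x.1) else 0) := by
    refine Summable.of_norm_bounded (hW'.mul_of_nonneg (summable_norm_natCast_cpow hr₁)
      (fun _ => norm_nonneg _) (fun _ => norm_nonneg _)) ?_
    rintro ⟨m, d⟩
    dsimp only
    split_ifs
    · rw [norm_mul, mul_comm]
    · rw [norm_zero]
      positivity
  have hrow : ∀ m : ℤ, ∑' d : ℕ, (if 0 < d ∧ (d : ℤ) ∣ m then (d : ℂ) ^ r₁ * W (n - m) else 0) =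
      dsigma r₁ m * W (n - m) + (if m = 0 then riemannZeta (-r₁) * W n else 0) := by
    intro m
    split_ifs with hm
    · subst hm
      rw [dsigma_zero, zero_mul, zero_add,
        zeta_eq_tsum_one_div_nat_cpow (by rw [Complex.neg_re]; linarith), ← tsum_mul_right]
      refine tsum_congr fun d => ?_
      rcases Nat.eq_zero_or_pos d with rfl | hd
      · have : -r₁ ≠ 0 := fun h => by
          rw [neg_eq_zero.mp h] at hr₁
          norm_num at hr₁
        simp [Complex.zero_cpow this]
      · simp [hd, Complex.cpow_neg]
    · rw [(hasSum_dsigma_mul _ hm _).tsum_eq, add_zero]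
  have hcol : ∀ d : ℕ, ∑' m : ℤ, (if 0 < d ∧ (d : ℤ) ∣ m then (d : ℂ) ^ r₁ * W (n - m) else 0) =
      if 0 < d then (d : ℂ) ^ r₁ * ∑' k : ℤ, W k * (if (d : ℤ) ∣ n - k then 1 else 0) else 0 := by
    intro d
    split_ifs with hd
    · rw [← tsum_mul_left, ← (Equiv.subLeft n).tsum_eq]
      refine tsum_congr fun k => ?_
      simp [hd]
    · simp [hd]
  have hzero : HasSum (fun m : ℤ => if m = 0 then riemannZeta (-r₁) * W n else 0)
      (riemannZeta (-r₁) * W n) := hasSum_ite_eq 0 _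
  have hsum : Summable (fun m : ℤ => dsigma r₁ m * W (n - m)) :=
    ((hs.prod.congr hrow).sub hzero.summable).congr fun m => add_sub_cancel_right _ _
  refine ⟨hsum, ?_⟩
  have hcomm := Summable.tsum_comm (f := fun (m : ℤ) (d : ℕ) =>
    if 0 < d ∧ (d : ℤ) ∣ m then (d : ℂ) ^ r₁ * W (n - m) else 0) hs
  have heq := (tsum_congr hcol).symm.trans (hcomm.trans ((tsum_congr hrow).trans
    (hsum.hasSum.add hzero).tsum_eq))
  exact heq ▸ (hs.prod_symm.prod.congr hcol).hasSum

/-- Theorem 1.1 of the paper (exact evaluation of the shifted convolution sum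
`∑_{n₁+n₂=n} σ_{r₁}(n₁)·σ_{r₂}(n₂)·n₂^P`), with all sums converging absolutely. -/
theorem shifted_convolution_poly (n : ℤ) (hn : n ≠ 0) (r₂ : ℝ) (r₁ : ℂ)
    (hr₁ : r₁.re < -1) (P : ℤ) (hP : (P : ℝ) ≤ -3 - |r₂|)
    (bstar : ℕ → ℕ → ℤ)
    (hb : ∀ c d : ℕ, 0 < c → 0 < d → (Nat.gcd c d : ℤ) ∣ n →
      IsMinAbsB n c d (bstar c d)) :
    Summable (fun m : ℤ => if m ≠ 0 ∧ n - m ≠ 0 then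
        dsigma r₁ m * dsigma (r₂ : ℂ) (n - m) * ((n - m : ℤ) : ℂ) ^ P else 0) ∧
    (∀ d : ℕ, 0 < d → ¬ (d : ℤ) ∣ n → ∀ c' ∈ Finset.Icc 1 d, (Nat.gcd c' d : ℤ) ∣ n →
      Summable (fun m : ℤ => ((m : ℝ) + uval c' d (bstar c' d)) ^ P)) ∧
    Summable (fun d : ℕ => if 0 < d ∧ ¬ (d : ℤ) ∣ n then
        (d : ℂ) ^ (r₁ + (r₂ : ℂ) + 2 * (P : ℂ)) *
          ∑ c' ∈ Finset.Icc 1 d, (if (Nat.gcd c' d : ℤ) ∣ n then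
            (Nat.gcd c' d : ℂ) ^ (-P) * hzeta (-(r₂ : ℂ) - (P : ℂ)) ((c' : ℝ) / d) *
              ((∑' m : ℤ, ((m : ℝ) + uval c' d (bstar c' d)) ^ P : ℝ) : ℂ) else 0)
      else 0) ∧
    (∑' m : ℤ, if m ≠ 0 ∧ n - m ≠ 0 then
        dsigma r₁ m * dsigma (r₂ : ℂ) (n - m) * ((n - m : ℤ) : ℂ) ^ P else 0) =
      - (n : ℂ) ^ P * dsigma (r₂ : ℂ) n * riemannZeta (-r₁)
      + (-1 : ℂ) ^ P * 2 * (if 2 ∣ P then (1 : ℂ) else 0) * riemannZeta (-(P : ℂ)) *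
          riemannZeta (-(r₂ : ℂ) - (P : ℂ)) *
          (∑ d ∈ n.natAbs.divisors, (d : ℂ) ^ (r₁ + (P : ℂ)) *
            ∏ p ∈ d.primeFactors,
              (1 + (1 - (p : ℂ) ^ P) *
                ∑ j ∈ Finset.Icc 1 (d.factorization p), (p : ℂ) ^ ((j : ℂ) * (r₂ : ℂ))))
      + (-1 : ℂ) ^ P *
          ∑' d : ℕ, (if 0 < d ∧ ¬ (d : ℤ) ∣ n then
            (d : ℂ) ^ (r₁ + (r₂ : ℂ) + 2 * (P : ℂ)) *
              ∑ c' ∈ Finset.Icc 1 d, (if (Nat.gcd c' d : ℤ) ∣ n then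
                (Nat.gcd c' d : ℂ) ^ (-P) * hzeta (-(r₂ : ℂ) - (P : ℂ)) ((c' : ℝ) / d) *
                  ((∑' m : ℤ, ((m : ℝ) + uval c' d (bstar c' d)) ^ P : ℝ) : ℂ) else 0)
          else 0) := by
  have hP3 := le_neg_three_of_le hP
  set W : ℤ → ℂ := fun k => dsigma (r₂ : ℂ) k * (k : ℂ) ^ P with hW
  set t : ℕ → ℂ := fun d => (d : ℂ) ^ (r₁ + (r₂ : ℂ) + 2 * (P : ℂ)) *
    ∑ c' ∈ Finset.Icc 1 d, (if (Nat.gcd c' d : ℤ) ∣ n then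
      (Nat.gcd c' d : ℂ) ^ (-P) * hzeta (-(r₂ : ℂ) - (P : ℂ)) ((c' : ℝ) / d) *
        ((∑' m : ℤ, ((m : ℝ) + uval c' d (bstar c' d)) ^ P : ℝ) : ℂ) else 0) with ht
  obtain ⟨hsum, hmain⟩ := summable_and_hasSum_dsigma_mul hr₁ n (summable_dsigma_mul_zpow hP)
  have hterm : ∀ m : ℤ, dsigma r₁ m * W (n - m) = if m ≠ 0 ∧ n - m ≠ 0 then
      dsigma r₁ m * dsigma (r₂ : ℂ) (n - m) * ((n - m : ℤ) : ℂ) ^ P else 0 := by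
    intro m
    split_ifs with h
    · rw [hW, mul_assoc]
    · rcases not_and_or.mp h with h | h
      · rw [not_not.mp h, dsigma_zero, zero_mul]
      · simp only [hW, not_not.mp h, dsigma_zero, zero_mul, mul_zero]
  have hsign : (-1 : ℂ) ^ P ≠ 0 := zpow_ne_zero _ (by norm_num)
  set H : ℕ → ℂ := fun d => if 0 < d then
    (d : ℂ) ^ r₁ * ∑' k : ℤ, W k * (if (d : ℤ) ∣ n - k then 1 else 0) else 0 with hH
  have hnon : ∀ d : ℕ, {d : ℕ | ¬ (d : ℤ) ∣ n}.indicator H d =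
      (-1 : ℂ) ^ P * if 0 < d ∧ ¬ (d : ℤ) ∣ n then t d else 0 := by
    intro d
    by_cases hdn : (d : ℤ) ∣ n
    · simp [hdn]
    · rw [Set.indicator_of_mem hdn]
      rcases Nat.eq_zero_or_pos d with rfl | hd
      · simp [hH]
      · simp only [hH, hd, hdn, not_false_eq_true, and_self, if_true]
        exact tsum_dsigma_residue hP n hd
          (fun c hc hg => (hb c d (Finset.mem_Icc.mp hc).1 hd hg).1) r₁
  have hnonsum : Summable (fun d : ℕ => if 0 < d ∧ ¬ (d : ℤ) ∣ n then t d else 0) :=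
    (summable_mul_left_iff hsign).mp ((hmain.summable.indicator _).congr hnon)
  have hdiv : ∑' d, {d : ℕ | ¬ (d : ℤ) ∣ n}ᶜ.indicator H d =
      (-1 : ℂ) ^ P * 2 * (if 2 ∣ P then (1 : ℂ) else 0) * riemannZeta (-(P : ℂ)) *
        riemannZeta (-(r₂ : ℂ) - (P : ℂ)) *
        (∑ d ∈ n.natAbs.divisors, (d : ℂ) ^ (r₁ + (P : ℂ)) *
          ∏ p ∈ d.primeFactors,
            (1 + (1 - (p : ℂ) ^ P) *
              ∑ j ∈ Finset.Icc 1 (d.factorization p), (p : ℂ) ^ ((j : ℂ) * (r₂ : ℂ)))) := by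
    rw [tsum_eq_sum (s := n.natAbs.divisors), Finset.mul_sum]
    · refine Finset.sum_congr rfl fun d hd => ?_
      have hdn : (d : ℤ) ∣ n := Int.natCast_dvd.mpr (Nat.dvd_of_mem_divisors hd)
      have hd0 : 0 < d := Nat.pos_of_mem_divisors hd
      have hd' : (d : ℂ) ≠ 0 := by exact_mod_cast hd0.ne'
      rw [Set.indicator_of_mem (by simpa using hdn)]
      simp only [hH, hd0, if_true, hW]
      rw [tsum_dsigma_of_dvd hd0 hdn, tsum_dsigma_mul_left hP hd0.ne', tsum_intCast_zpow hP3,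
        Complex.cpow_add _ _ hd', Complex.cpow_intCast]
      split_ifs with hPe
      · rw [(even_iff_two_dvd.mpr hPe).neg_one_zpow]
        ring
      · ring
    · intro d hd
      rw [Set.indicator_apply_eq_zero]
      intro hdn
      exact absurd (Nat.mem_divisors.mpr ⟨Int.natCast_dvd.mp (by simpa using hdn),
        Int.natAbs_ne_zero.mpr hn⟩) hd
  have hsplit : ∑' d, H d = ∑' d, {d : ℕ | ¬ (d : ℤ) ∣ n}.indicator H d +
      ∑' d, {d : ℕ | ¬ (d : ℤ) ∣ n}ᶜ.indicator H d := by
    rw [← (hmain.summable.indicator _).tsum_add (hmain.summable.indicator _)]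
    exact tsum_congr fun d => (congrFun (Set.indicator_self_add_compl _ H) d).symm
  refine ⟨hsum.congr hterm, fun d hd _ c' _ _ => summable_add_uval_zpow hP3 hd _, hnonsum, ?_⟩
  rw [← tsum_congr hterm]
  rw [hmain.tsum_eq, tsum_congr hnon, tsum_mul_left, hdiv] at hsplit
  have hWn : W n = dsigma (r₂ : ℂ) n * (n : ℂ) ^ P := rfl
  linear_combination hsplit - riemannZeta (-r₁) * hWn
end

section
/- Let n be a nonzero integer, d a positive integer with d ∤ n, r₂ an even integer, and P ∈ ℤ with P ≠ −1 and r₂ + P ≥ 0. For each c' with 0 < c' ≤ d and gcd(c',d) ∣ n, let ã_{c'} ∈ (0,1) be the fractional part of u_{c',d} (which is not an integer since d ∤ n). Then ∑_{0<c'≤d, gcd(c',d)∣n} gcd(c',d)^{−P}·ζ(−(r₂+P), c'/d)·( ζ(−P, ã_{c'}) + (−1)^P·ζ(−P, 1−ã_{c'}) ) = 0. -/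
open scoped BigOperators

open HurwitzZeta in
/-- Parity of the Hurwitz zeta function at nonpositive integers. -/
theorem hurwitzZeta_neg_of_neg_nat {x : UnitAddCircle} (hx : x ≠ 0) (N : ℕ) :
    hurwitzZeta (-x) (-(N : ℂ)) = (-1) ^ (N + 1) * hurwitzZeta x (-(N : ℂ)) := by
  simp only [hurwitzZeta, hurwitzZetaEven_neg, hurwitzZetaOdd_neg]
  rcases Nat.even_or_odd' N with ⟨k, rfl | rfl⟩
  · have hE : hurwitzZetaEven x (-((2 * k : ℕ) : ℂ)) = 0 := by
      rcases k with _ | k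
      · simp [hurwitzZetaEven_apply_zero, hx]
      · have := hurwitzZetaEven_neg_two_mul_nat_add_one x k
        convert this using 2
        push_cast; ring
    rw [hE, pow_succ, pow_mul]
    simp
  · have hO : hurwitzZetaOdd x (-((2 * k + 1 : ℕ) : ℂ)) = 0 := by
      have := hurwitzZetaOdd_neg_two_mul_nat_sub_one x k
      convert this using 2
      push_cast; ring
    rw [hO, show 2 * k + 1 + 1 = 2 * (k + 1) by ring, pow_mul]
    simp

theorem UnitAddCircle.coe_fract (x : ℝ) : ((Int.fract x : ℝ) : UnitAddCircle) = x := by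
  rw [Int.fract, AddCircle.coe_sub, sub_eq_self]
  exact (AddCircle.coe_eq_zero_iff 1).2 ⟨⌊x⌋, by simp⟩

theorem UnitAddCircle.coe_one_sub (x : ℝ) : ((1 - x : ℝ) : UnitAddCircle) = -x := by
  rw [AddCircle.coe_sub, AddCircle.coe_period, zero_sub]

/-- If `b` and `b'` solve the congruences attached to `c` and `d - c`, then `u_{c,d}` and
`u_{d-c,d}` are opposite modulo `1`. -/
theorem coe_uval_sub_eq_neg {n : ℤ} {c d : ℕ} (hd : 0 < d) (hc : c ≤ d) {b b' : ℤ}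
    (hb : ∃ a : ℤ, a * d - b * c = n) (hb' : ∃ a : ℤ, a * d - b' * (d - c : ℕ) = n) :
    (uval (d - c) d b' : UnitAddCircle) = -(uval c d b : UnitAddCircle) := by
  obtain ⟨a, ha⟩ := hb
  obtain ⟨a', ha'⟩ := hb'
  push_cast [hc] at ha'
  have hdvd : (d : ℤ) ∣ (b' + b) * (Nat.gcd c d : ℤ) := by
    rw [Nat.gcd_eq_gcd_ab, mul_add]
    refine dvd_add ?_ ⟨(b' + b) * Nat.gcdB c d, by ring⟩
    rw [← mul_assoc]
    refine Dvd.dvd.mul_right ⟨a - a' + b', by linarith⟩ _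
  obtain ⟨k, hk⟩ := hdvd
  have hd0 : (d : ℝ) ≠ 0 := by positivity
  rw [← sub_eq_zero, sub_neg_eq_add, ← AddCircle.coe_add, AddCircle.coe_eq_zero_iff]
  refine ⟨k, ?_⟩
  have hgcd : Nat.gcd (d - c) d = Nat.gcd c d := by
    rw [Nat.gcd_comm, Nat.gcd_self_sub_right hc, Nat.gcd_comm]
  have hk' : ((b' : ℝ) + b) * (Nat.gcd c d : ℝ) = d * k := by exact_mod_cast hk
  simp only [uval, hgcd, zsmul_eq_mul, mul_one]
  rw [← add_div, eq_div_iff hd0]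
  push_cast
  linarith

/-- Vanishing of the inner sum in the third term of the main polynomial identity:
for `n ≠ 0`, `d ∤ n`, `r₂` even, `P ≠ −1` with `r₂ + P ≥ 0`,
`∑_{0<c'≤d, gcd(c',d)∣n} gcd(c',d)^{−P}·ζ(−(r₂+P), c'/d)·
   (ζ(−P, ã_{c'}) + (−1)^P·ζ(−P, 1−ã_{c'})) = 0`,
where `ã_{c'}` is the fractional part of `u_{c',d}`. -/
theorem inner_sum_vanishes_poly (n : ℤ) (hn : n ≠ 0) (d : ℕ) (hd : 0 < d)
    (hdn : ¬ (d : ℤ) ∣ n) (r₂ : ℤ) (hr₂ : Even r₂) (P : ℤ) (hP : P ≠ -1)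
    (hrP : 0 ≤ r₂ + P)
    (bstar : ℕ → ℤ)
    (hb : ∀ c' ∈ Finset.Icc 1 d, (Nat.gcd c' d : ℤ) ∣ n → IsMinAbsB n c' d (bstar c')) :
    ∑ c' ∈ Finset.Icc 1 d, (if (Nat.gcd c' d : ℤ) ∣ n then
      (Nat.gcd c' d : ℂ) ^ (-P) * hzeta (-((r₂ : ℂ) + (P : ℂ))) ((c' : ℝ) / d) *
        (hzeta (-(P : ℂ)) (Int.fract (uval c' d (bstar c'))) +
          (-1 : ℂ) ^ P * hzeta (-(P : ℂ)) (1 - Int.fract (uval c' d (bstar c'))))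
      else 0) = 0 := by
  obtain ⟨N, hN⟩ := Int.eq_ofNat_of_zero_le hrP
  have hNC : (r₂ : ℂ) + (P : ℂ) = (N : ℂ) := by exact_mod_cast hN
  have hsign : (-1 : ℂ) ^ P * (-1) ^ P = 1 := by
    rw [← mul_zpow]; simp
  have hparity : (-1 : ℂ) ^ (N + 1) = -(-1) ^ P := by
    have : ((-1 : ℂ) ^ N) = (-1) ^ P := by
      rw [← zpow_natCast, ← show r₂ + P = (N : ℤ) from hN, zpow_add₀ (by norm_num),
        hr₂.neg_one_zpow, one_mul]
    rw [pow_succ, this]; ring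
  simp only [hzeta, hNC, UnitAddCircle.coe_one_sub, UnitAddCircle.coe_fract]
  set f : ℕ → ℂ := fun c' => if (Nat.gcd c' d : ℤ) ∣ n then
    (Nat.gcd c' d : ℂ) ^ (-P) * HurwitzZeta.hurwitzZeta ((c' : ℝ) / d : ℝ) (-(N : ℂ)) *
      (HurwitzZeta.hurwitzZeta (uval c' d (bstar c')) (-(P : ℂ)) +
        (-1 : ℂ) ^ P * HurwitzZeta.hurwitzZeta (-(uval c' d (bstar c') : UnitAddCircle)) (-(P : ℂ)))
    else 0
  rw [← Finset.sum_subset (s₁ := Finset.Ioo 0 d)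
    (fun c hc => by simp only [Finset.mem_Ioo, Finset.mem_Icc] at hc ⊢; omega)
    (fun c hc hc' => by
      have : c = d := by simp only [Finset.mem_Ioo, Finset.mem_Icc] at hc hc'; omega
      subst this
      simp [hdn])]
  have hpair : ∀ c ∈ Finset.Ioo 0 d, f c + f (d - c) = 0 := by
    intro c hc
    rw [Finset.mem_Ioo] at hc
    have hgcd : Nat.gcd (d - c) d = Nat.gcd c d := by
      rw [Nat.gcd_comm, Nat.gcd_self_sub_right hc.2.le, Nat.gcd_comm]
    simp only [f, hgcd]
    split_ifs with hg
    · have hu := coe_uval_sub_eq_neg hd hc.2.le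
        (hb c (Finset.mem_Icc.2 ⟨hc.1, hc.2.le⟩) hg).1
        (hb (d - c) (Finset.mem_Icc.2 ⟨by omega, by omega⟩) (by rwa [hgcd])).1
      have hd0 : (0 : ℝ) < d := by exact_mod_cast hd
      have hcd : (((d - c : ℕ) : ℝ) / d : ℝ) = 1 - (c : ℝ) / d := by
        rw [Nat.cast_sub hc.2.le]; field_simp
      have hx : (((c : ℝ) / d : ℝ) : UnitAddCircle) ≠ 0 := by
        intro h
        obtain ⟨k, hk⟩ := (AddCircle.coe_eq_zero_iff 1).1 h
        rw [zsmul_eq_mul, mul_one, eq_div_iff hd0.ne'] at hk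
        have hk' : k * (d : ℤ) = c := by exact_mod_cast hk
        exact absurd (Int.le_of_dvd (by omega) ⟨k, by linarith⟩) (by omega : ¬ (d : ℤ) ≤ c)
      rw [hcd, UnitAddCircle.coe_one_sub, hurwitzZeta_neg_of_neg_nat hx, hparity, hu, neg_neg]
      linear_combination (-(Nat.gcd c d : ℂ) ^ (-P)
        * HurwitzZeta.hurwitzZeta ((c : ℝ) / d : ℝ) (-(N : ℂ))
        * HurwitzZeta.hurwitzZeta (uval c d (bstar c)) (-(P : ℂ))) * hsign
    · simp
  refine Finset.sum_involution (fun c _ => d - c) hpair ?_ ?_ ?_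
  · intro c hc hne heq
    have h := hpair c hc
    rw [heq] at h
    exact hne (self_eq_neg.1 (eq_neg_of_add_eq_zero_left h))
  · intro c hc
    simp only [Finset.mem_Ioo] at hc ⊢; omega
  · intro c hc
    simp only [Finset.mem_Ioo] at hc; omega
end

section
/- Let n be a nonzero integer, r₂ ∈ ℝ, r₁ ∈ ℂ with Re(r₁) < −1, and Q ∈ ℤ with Q ≤ −3 − |r₂|. Then all sums below converge absolutely and ∑_{n₁+n₂=n, n₁,n₂∈ℤ∖{0}} σ_{r₁}(n₁)·σ_{r₂}(n₂)·n₂^Q·log|n₂| = −ζ(−r₁)·σ_{r₂}(n)·n^Q·log|n| + (−1)^Q·2·δ_{2∣Q}·ζ(−Q)·∑_{d∣|n|} d^{Q+r₁} ∑_{c∈ℕ} c^{r₂+Q}·gcd(c,d)^{−Q}·(log c − log gcd(c,d)) + (−1)^Q·2·δ_{2∣Q}·∑_{d∣|n|} d^{Q+r₁}·(log(d)·ζ(−Q) − ζ'(−Q))·∑_{c∈ℕ} c^{r₂+Q}·gcd(c,d)^{−Q} + (−1)^Q ∑_{d∈ℕ, d∤n} d^{r₁} ∑_{c∈ℕ,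 gcd(c,d)∣n} c^{r₂}·(cd/gcd(c,d))^Q·log(cd/gcd(c,d))·∑_{m∈ℤ}(m+u_{c,d})^Q + (−1)^Q ∑_{d∈ℕ, d∤n} d^{r₁+r₂+2Q} ∑_{0<c'≤d, gcd(c',d)∣n} gcd(c',d)^{−Q}·ζ(−r₂−Q, c'/d)·∑_{m∈ℤ}(m+u_{c',d})^Q·log|m+u_{c',d}|. -/
open scoped BigOperators

/-- The term of the shifted convolution sum indexed by a divisor `d` of `n - N`, a divisor `c` of `N`
and `N` itself. -/
noncomputable def shiftTerm (n : ℤ) (r₁ : ℂ) (r₂ : ℝ) (Q : ℤ) (d c : ℕ) (N : ℤ) : ℂ :=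
  if (c : ℤ) ∣ N ∧ (d : ℤ) ∣ n - N then
    (d : ℂ) ^ r₁ * (c : ℂ) ^ (r₂ : ℂ) * (N : ℂ) ^ Q * (Real.log |(N : ℝ)| : ℂ) else 0

lemma norm_shiftTerm_le (n : ℤ) {r₁ : ℂ} (hr₁ : r₁.re < -1) {r₂ : ℝ} {Q : ℤ}
    (hQ : (Q : ℝ) ≤ -3 - |r₂|) (d c : ℕ) (N : ℤ) :
    ‖shiftTerm n r₁ r₂ Q d c N‖ ≤
      (d : ℝ) ^ r₁.re * (2 * (c : ℝ) ^ (-(5 / 4) : ℝ)) * |(N : ℝ)| ^ (-(5 / 4) : ℝ) := by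
  have hnn : 0 ≤ (d : ℝ) ^ r₁.re * (2 * (c : ℝ) ^ (-(5 / 4) : ℝ)) * |(N : ℝ)| ^ (-(5 / 4) : ℝ) := by
    positivity
  unfold shiftTerm
  split_ifs with h
  swap
  · simpa only [norm_zero] using hnn
  obtain ⟨⟨b, hb⟩, -⟩ := h
  rcases eq_or_ne N 0 with rfl | hN
  · simp
  have hc : c ≠ 0 := by rintro rfl; simp [hb] at hN
  have hc0 : 0 < c := Nat.pos_of_ne_zero hc
  have hb0 : b ≠ 0 := by rintro rfl; simp [hb] at hN
  have hcR : (1 : ℝ) ≤ c := by exact_mod_cast hc0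
  have hNR : (1 : ℝ) ≤ |(N : ℝ)| := by exact_mod_cast Int.one_le_abs hN
  have hcN : (c : ℝ) ≤ |(N : ℝ)| := by
    have : (1 : ℝ) ≤ |(b : ℝ)| := by exact_mod_cast Int.one_le_abs hb0
    rw [hb]; push_cast; rw [abs_mul, Nat.abs_cast]; nlinarith
  have hlog : Real.log |(N : ℝ)| ≤ 2 * |(N : ℝ)| ^ (1 / 2 : ℝ) := by
    have := Real.log_le_rpow_div (x := |(N : ℝ)|) (ε := 1 / 2) (by positivity) (by norm_num)
    linarith
  have hlog0 : 0 ≤ Real.log |(N : ℝ)| := Real.log_nonneg hNR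
  have hN0 : 0 < |(N : ℝ)| := by linarith
  have hr : (c : ℝ) ^ r₂ ≤ |(N : ℝ)| ^ |r₂| :=
    (Real.rpow_le_rpow_of_exponent_le hcR (le_abs_self _)).trans
      (Real.rpow_le_rpow (by positivity) hcN (abs_nonneg _))
  have hNQ : ‖(N : ℂ) ^ Q‖ = |(N : ℝ)| ^ (Q : ℝ) := by
    rw [norm_zpow, Complex.norm_intCast, Real.rpow_intCast]
  rw [norm_mul, norm_mul, norm_mul, hNQ, Complex.norm_real, Real.norm_of_nonneg hlog0,
    Complex.norm_natCast_cpow_of_pos hc0, Complex.ofReal_re,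
    Complex.norm_natCast_cpow_of_re_ne_zero _ (by linarith)]
  have key : (c : ℝ) ^ r₂ * |(N : ℝ)| ^ (Q : ℝ) * Real.log |(N : ℝ)| ≤
      2 * (c : ℝ) ^ (-(5 / 4) : ℝ) * |(N : ℝ)| ^ (-(5 / 4) : ℝ) := by
    calc (c : ℝ) ^ r₂ * |(N : ℝ)| ^ (Q : ℝ) * Real.log |(N : ℝ)|
        ≤ |(N : ℝ)| ^ |r₂| * |(N : ℝ)| ^ (-3 - |r₂|) * (2 * |(N : ℝ)| ^ (1 / 2 : ℝ)) := by gcongr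
      _ = 2 * |(N : ℝ)| ^ (-(5 / 4) : ℝ) * |(N : ℝ)| ^ (-(5 / 4) : ℝ) := by
        have : |(N : ℝ)| ^ |r₂| * |(N : ℝ)| ^ (-3 - |r₂|) * |(N : ℝ)| ^ (1 / 2 : ℝ) =
            |(N : ℝ)| ^ (-(5 / 4) : ℝ) * |(N : ℝ)| ^ (-(5 / 4) : ℝ) := by
          rw [← Real.rpow_add hN0, ← Real.rpow_add hN0, ← Real.rpow_add hN0]
          congr 1; ring
        linear_combination 2 * this
      _ ≤ _ := by
        gcongr 2 * ?_ * _
        exact Real.rpow_le_rpow_of_nonpos (by linarith) hcN (by norm_num)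
  calc _ = (d : ℝ) ^ r₁.re *
        ((c : ℝ) ^ r₂ * |(N : ℝ)| ^ (Q : ℝ) * Real.log |(N : ℝ)|) := by ring
    _ ≤ (d : ℝ) ^ r₁.re * (2 * (c : ℝ) ^ (-(5 / 4) : ℝ) * |(N : ℝ)| ^ (-(5 / 4) : ℝ)) := by gcongr
    _ = _ := by ring

lemma summable_shiftTerm (n : ℤ) {r₁ : ℂ} (hr₁ : r₁.re < -1) {r₂ : ℝ} {Q : ℤ}
    (hQ : (Q : ℝ) ≤ -3 - |r₂|) :
    Summable (fun p : (ℕ × ℕ) × ℤ => shiftTerm n r₁ r₂ Q p.1.1 p.1.2 p.2) := by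
  refine Summable.of_norm_bounded ?_ fun p => norm_shiftTerm_le n hr₁ hQ p.1.1 p.1.2 p.2
  have h1 : Summable (fun d : ℕ => (d : ℝ) ^ r₁.re) := Real.summable_nat_rpow.2 hr₁
  have h2 : Summable (fun c : ℕ => 2 * (c : ℝ) ^ (-(5 / 4) : ℝ)) :=
    (Real.summable_nat_rpow.2 (by norm_num)).mul_left 2
  have h3 : Summable (fun N : ℤ => |(N : ℝ)| ^ (-(5 / 4) : ℝ)) :=
    Real.summable_abs_int_rpow (by norm_num)
  exact (h1.mul_of_nonneg h2 (fun _ => by positivity) fun _ => by positivity).mul_of_nonneg h3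
    (fun _ => by positivity) fun _ => by positivity

lemma hasSum_ite_dvd_cpow (ν : ℂ) {m : ℤ} (hm : m ≠ 0) :
    HasSum (fun d : ℕ => if (d : ℤ) ∣ m then (d : ℂ) ^ ν else 0) (dsigma ν m) := by
  have h : dsigma ν m = ∑ d ∈ m.natAbs.divisors, if (d : ℤ) ∣ m then (d : ℂ) ^ ν else 0 := by
    refine Finset.sum_congr rfl fun d hd => ?_
    rw [if_pos (Int.natCast_dvd.2 (Nat.dvd_of_mem_divisors hd))]
  rw [h]
  refine hasSum_sum_of_ne_finset_zero fun d hd => if_neg fun h => hd ?_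
  exact Nat.mem_divisors.2 ⟨Int.natCast_dvd.1 h, by simpa using hm⟩

lemma tsum_natCast_cpow {r : ℂ} (hr : r.re < -1) : ∑' d : ℕ, (d : ℂ) ^ r = riemannZeta (-r) := by
  rw [zeta_eq_tsum_one_div_nat_cpow (by simpa using by linarith)]
  simp [Complex.cpow_neg]

lemma summable_norm_natCast_cpow_s3 {r : ℂ} (hr : r.re < -1) :
    Summable (fun d : ℕ => ‖(d : ℂ) ^ r‖) := by
  simpa [Complex.norm_natCast_cpow_of_re_ne_zero _ (show r.re ≠ 0 by linarith)] using hr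

lemma tsum_shiftTerm_divisors (n : ℤ) {r₁ : ℂ} (hr₁ : r₁.re < -1) (r₂ : ℝ) (Q : ℤ)
    (N : ℤ) :
    ∑' p : ℕ × ℕ, shiftTerm n r₁ r₂ Q p.1 p.2 N =
      (if n - N ≠ 0 ∧ N ≠ 0 then
        dsigma r₁ (n - N) * dsigma (r₂ : ℂ) N * (N : ℂ) ^ Q * (Real.log |(N : ℝ)| : ℂ) else 0) +
      (if N = n then riemannZeta (-r₁) * dsigma (r₂ : ℂ) n * (n : ℂ) ^ Q * (Real.log |(n : ℝ)| : ℂ)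
        else 0) := by
  have hfac : ∀ p : ℕ × ℕ, shiftTerm n r₁ r₂ Q p.1 p.2 N =
      ((if (p.1 : ℤ) ∣ n - N then (p.1 : ℂ) ^ r₁ else 0) *
        (if (p.2 : ℤ) ∣ N then (p.2 : ℂ) ^ (r₂ : ℂ) else 0)) *
      ((N : ℂ) ^ Q * (Real.log |(N : ℝ)| : ℂ)) := by
    intro p
    unfold shiftTerm
    split_ifs <;> first | tauto | ring
  rw [tsum_congr hfac, tsum_mul_right]
  rcases eq_or_ne N 0 with rfl | hN
  · simp +contextual
  have hs1 : Summable (fun d : ℕ => ‖(if (d : ℤ) ∣ n - N then (d : ℂ) ^ r₁ else 0 : ℂ)‖) := by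
    refine (summable_norm_natCast_cpow_s3 hr₁).of_nonneg_of_le (fun _ => norm_nonneg _) fun d => ?_
    split_ifs <;> simp
  have hs2 := hasSum_ite_dvd_cpow (r₂ : ℂ) hN
  rw [← tsum_mul_tsum_of_summable_norm hs1 hs2.summable.norm, hs2.tsum_eq]
  rcases eq_or_ne (n - N) 0 with h | h
  · have : N = n := by omega
    subst this
    simp [tsum_natCast_cpow hr₁]
    ring
  · rw [(hasSum_ite_dvd_cpow r₁ h).tsum_eq, if_pos ⟨h, hN⟩, if_neg (by omega)]
    ring

lemma natCast_dvd_mul_natCast_iff {c d : ℕ} (hc : 0 < c) (x : ℤ) :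
    (d : ℤ) ∣ x * c ↔ ((d / Nat.gcd c d : ℕ) : ℤ) ∣ x := by
  have hg : 0 < Nat.gcd c d := Nat.gcd_pos_of_pos_left d hc
  have hcop : IsCoprime ((d / Nat.gcd c d : ℕ) : ℤ) ((c / Nat.gcd c d : ℕ) : ℤ) :=
    Nat.isCoprime_iff_coprime.2 (Nat.coprime_div_gcd_div_gcd hg).symm
  have hc' : (c : ℤ) = (Nat.gcd c d : ℤ) * ((c / Nat.gcd c d : ℕ) : ℤ) := by
    exact_mod_cast (Nat.mul_div_cancel' (Nat.gcd_dvd_left c d)).symm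
  have hd' : (d : ℤ) = (Nat.gcd c d : ℤ) * ((d / Nat.gcd c d : ℕ) : ℤ) := by
    exact_mod_cast (Nat.mul_div_cancel' (Nat.gcd_dvd_right c d)).symm
  have hg' : (Nat.gcd c d : ℤ) ≠ 0 := by exact_mod_cast hg.ne'
  generalize c / Nat.gcd c d = c' at *
  generalize d / Nat.gcd c d = d' at *
  generalize Nat.gcd c d = g at *
  rw [hc', hd', mul_left_comm, mul_dvd_mul_iff_left hg']
  exact ⟨hcop.dvd_of_dvd_mul_right, fun h => h.mul_right _⟩

lemma dvd_and_dvd_sub_iff {n a b : ℤ} {c d : ℕ} (hc : 0 < c)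
    (hab : a * d - b * c = n) (N : ℤ) :
    ((c : ℤ) ∣ N ∧ (d : ℤ) ∣ n - N) ↔
      ∃ m : ℤ, N = -((b + ((d / Nat.gcd c d : ℕ) : ℤ) * m) * c) := by
  have key : ∀ x : ℤ, (d : ℤ) ∣ n + x * c ↔ ((d / Nat.gcd c d : ℕ) : ℤ) ∣ x - b := by
    intro x
    rw [← natCast_dvd_mul_natCast_iff hc,
      show n + x * c = a * d + (x - b) * c by rw [← hab]; ring]
    exact dvd_add_right (dvd_mul_left _ _)
  constructor
  · rintro ⟨⟨e, rfl⟩, h⟩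
    obtain ⟨m, hm⟩ := (key (-e)).1 (by rw [show n + -e * c = n - c * e by ring]; exact h)
    exact ⟨m, by linear_combination (-(c : ℤ)) * hm⟩
  · rintro ⟨m, rfl⟩
    refine ⟨(dvd_mul_left _ _).neg_right, ?_⟩
    rw [sub_neg_eq_add, key]
    exact ⟨m, by ring⟩

lemma natCast_mul_add_uval {c d : ℕ} (hc : 0 < c) (hd : 0 < d) (b m : ℤ) :
    ((c * d / Nat.gcd c d : ℕ) : ℝ) * ((m : ℝ) + uval c d b) =
      (b + ((d / Nat.gcd c d : ℕ) : ℝ) * m) * c := by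
  have hg : 0 < Nat.gcd c d := Nat.gcd_pos_of_pos_left d hc
  have hg' : (Nat.gcd c d : ℝ) ≠ 0 := by exact_mod_cast hg.ne'
  have hd' : (d : ℝ) ≠ 0 := by exact_mod_cast hd.ne'
  rw [Nat.mul_div_assoc _ (Nat.gcd_dvd_right c d), uval, Nat.cast_mul,
    Nat.cast_div (Nat.gcd_dvd_right c d) hg']
  push_cast
  field_simp
  ring

lemma summable_add_zpow (u : ℝ) {Q : ℤ} (hQ : Q ≤ -2) :
    Summable (fun m : ℤ => |(m : ℝ) + u| ^ Q) := by
  have h := (Real.summable_one_div_int_add_rpow u (-(Q : ℝ))).2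
    (by have : (Q : ℝ) ≤ -2 := by exact_mod_cast hQ
        linarith)
  refine h.congr fun m => ?_
  rw [← Int.cast_neg, Real.rpow_intCast, zpow_neg, one_div, inv_inv]

lemma abs_log_abs_le (x : ℝ) : |Real.log (|x|)| ≤ |x| + |x|⁻¹ := by
  rcases eq_or_ne x 0 with rfl | hx
  · simp
  have h0 : 0 < |x| := abs_pos.2 hx
  have h1 := Real.log_le_sub_one_of_pos h0
  have h2 := Real.one_sub_inv_le_log_of_pos h0
  have : 0 < |x|⁻¹ := by positivity
  rw [abs_le]
  constructor <;> linarith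

lemma summable_add_zpow_mul_log (u : ℝ) {Q : ℤ} (hQ : Q ≤ -3) :
    Summable (fun m : ℤ => ((m : ℝ) + u) ^ Q * Real.log |(m : ℝ) + u|) := by
  refine Summable.of_norm_bounded
    ((summable_add_zpow u (Q := Q + 1) (by omega)).add
      (summable_add_zpow u (Q := Q - 1) (by omega))) fun m => ?_
  rcases eq_or_ne ((m : ℝ) + u) 0 with h | h
  · rw [h]; simp; positivity
  have h' : |(m : ℝ) + u| ≠ 0 := abs_ne_zero.2 h
  rw [norm_mul, norm_zpow, Real.norm_eq_abs, Real.norm_eq_abs, zpow_add_one₀ h',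
    zpow_sub_one₀ h', ← mul_add]
  gcongr
  exact abs_log_abs_le _

lemma tsum_shiftTerm_shift {n : ℤ} (r₁ : ℂ) (r₂ : ℝ) {Q : ℤ} (hQ : Q ≤ -3)
    {c d : ℕ} (hc : 0 < c) (hd : 0 < d) {a b : ℤ} (hab : a * d - b * c = n) :
    ∑' N : ℤ, shiftTerm n r₁ r₂ Q d c N =
      (-1) ^ Q * ((d : ℂ) ^ r₁ * ((c : ℂ) ^ (r₂ : ℂ) * ((c * d / Nat.gcd c d : ℕ) : ℂ) ^ Q *
          (Real.log ((c * d / Nat.gcd c d : ℕ) : ℝ) : ℂ) *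
          ((∑' m : ℤ, ((m : ℝ) + uval c d b) ^ Q : ℝ) : ℂ) +
        (c : ℂ) ^ (r₂ : ℂ) * ((c * d / Nat.gcd c d : ℕ) : ℂ) ^ Q *
          ((∑' m : ℤ, ((m : ℝ) + uval c d b) ^ Q * Real.log |(m : ℝ) + uval c d b| : ℝ) : ℂ))) := by
  have hg : 0 < Nat.gcd c d := Nat.gcd_pos_of_pos_left d hc
  have hdg : 0 < d / Nat.gcd c d := Nat.div_pos (Nat.gcd_le_right c hd) hg
  have hM : 0 < c * d / Nat.gcd c d := by
    rw [Nat.mul_div_assoc _ (Nat.gcd_dvd_right c d)]; positivity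
  set i : ℤ → ℤ := fun m => -((b + ((d / Nat.gcd c d : ℕ) : ℤ) * m) * c) with hi
  have hinj : Function.Injective i := by
    intro x y hxy
    have hc' : (c : ℤ) ≠ 0 := by exact_mod_cast hc.ne'
    have hd' : ((d / Nat.gcd c d : ℕ) : ℤ) ≠ 0 := by exact_mod_cast hdg.ne'
    simpa only [hi, neg_inj, mul_left_inj' hc', add_right_inj, mul_right_inj' hd'] using hxy
  have hsupp : Function.support (shiftTerm n r₁ r₂ Q d c) ⊆ Set.range i := by
    intro N hN
    rw [Function.mem_support, shiftTerm] at hN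
    obtain ⟨m, hm⟩ := (dvd_and_dvd_sub_iff hc hab N).1 (by by_contra h; simp [h] at hN)
    exact ⟨m, hm.symm⟩
  rw [← hinj.tsum_eq hsupp]
  set M := c * d / Nat.gcd c d
  set u := uval c d b
  have hterm : ∀ m : ℤ, shiftTerm n r₁ r₂ Q d c (i m) =
      ((-1) ^ Q * ((d : ℂ) ^ r₁ * (c : ℂ) ^ (r₂ : ℂ) * (M : ℂ) ^ Q)) *
      (((Real.log (M : ℝ) * ((m : ℝ) + u) ^ Q + ((m : ℝ) + u) ^ Q * Real.log |(m : ℝ) + u|) : ℝ) :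
        ℂ) := by
    intro m
    have hiR : ((i m : ℤ) : ℝ) = -((M : ℝ) * ((m : ℝ) + u)) := by
      rw [natCast_mul_add_uval hc hd]
      simp only [hi, Int.cast_neg, Int.cast_mul, Int.cast_add, Int.cast_natCast]
    have hiC : ((i m : ℤ) : ℂ) = (-1) * (M : ℂ) * (((m : ℝ) + u : ℝ) : ℂ) := by
      rw [← Complex.ofReal_intCast, hiR]; push_cast; ring
    rw [shiftTerm, if_pos ((dvd_and_dvd_sub_iff hc hab _).2 ⟨m, rfl⟩), hiR, hiC, mul_zpow,
      mul_zpow]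
    rcases eq_or_ne ((m : ℝ) + u) 0 with h | h
    · rw [h]; simp [zero_zpow Q (by omega)]
    · rw [abs_neg, abs_mul, Nat.abs_cast, Real.log_mul (by positivity) (abs_ne_zero.2 h)]
      push_cast; ring
  have hZ : Summable (fun m : ℤ => ((m : ℝ) + u) ^ Q) :=
    Summable.of_norm (by simpa using summable_add_zpow u (Q := Q) (by omega))
  have hL := summable_add_zpow_mul_log u hQ
  rw [tsum_congr hterm, tsum_mul_left, ← Complex.ofReal_tsum, (hZ.mul_left _).tsum_add hL,
    tsum_mul_left]
  push_cast
  ring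

/-- The summand of the part of the sum carrying the factor `log (lcm c d)`. -/
noncomputable def lcmLogTerm (n : ℤ) (r₂ : ℝ) (Q : ℤ) (bstar : ℕ → ℕ → ℤ) (d c : ℕ) : ℂ :=
  if 0 < c ∧ (Nat.gcd c d : ℤ) ∣ n then
    (c : ℂ) ^ (r₂ : ℂ) * ((c * d / Nat.gcd c d : ℕ) : ℂ) ^ Q *
      (Real.log ((c * d / Nat.gcd c d : ℕ) : ℝ) : ℂ) *
      ((∑' m : ℤ, ((m : ℝ) + uval c d (bstar c d)) ^ Q : ℝ) : ℂ) else 0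

/-- The summand of the part of the sum carrying the factors `log |m + u|`. -/
noncomputable def shiftLogTerm (n : ℤ) (r₂ : ℝ) (Q : ℤ) (bstar : ℕ → ℕ → ℤ) (d c : ℕ) : ℂ :=
  if 0 < c ∧ (Nat.gcd c d : ℤ) ∣ n then
    (c : ℂ) ^ (r₂ : ℂ) * ((c * d / Nat.gcd c d : ℕ) : ℂ) ^ Q *
      ((∑' m : ℤ, ((m : ℝ) + uval c d (bstar c d)) ^ Q *
        Real.log |(m : ℝ) + uval c d (bstar c d)| : ℝ) : ℂ) else 0

lemma tsum_shiftTerm {n : ℤ} {r₁ : ℂ} (hr₁ : r₁ ≠ 0) (r₂ : ℝ) {Q : ℤ} (hQ : Q ≤ -3)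
    {bstar : ℕ → ℕ → ℤ}
    (hb : ∀ c d : ℕ, 0 < c → 0 < d → (Nat.gcd c d : ℤ) ∣ n → IsMinAbsB n c d (bstar c d))
    (d c : ℕ) :
    ∑' N : ℤ, shiftTerm n r₁ r₂ Q d c N =
      (-1) ^ Q * ((d : ℂ) ^ r₁ * lcmLogTerm n r₂ Q bstar d c +
        (d : ℂ) ^ r₁ * shiftLogTerm n r₂ Q bstar d c) := by
  rcases Nat.eq_zero_or_pos d with rfl | hd
  · simp [shiftTerm, Complex.zero_cpow hr₁]
  rcases Nat.eq_zero_or_pos c with rfl | hc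
  · have : ∀ N, shiftTerm n r₁ r₂ Q d 0 N = 0 := by
      intro N
      unfold shiftTerm
      split_ifs with h
      · have : N = 0 := by simpa using h.1
        simp [this]
      · rfl
    simp [this, lcmLogTerm, shiftLogTerm]
  by_cases hg : (Nat.gcd c d : ℤ) ∣ n
  · obtain ⟨⟨a, ha⟩, -⟩ := hb c d hc hd hg
    rw [tsum_shiftTerm_shift r₁ r₂ hQ hc hd ha, lcmLogTerm, shiftLogTerm, if_pos ⟨hc, hg⟩,
      if_pos ⟨hc, hg⟩, mul_add ((d : ℂ) ^ r₁)]
  · have : ∀ N, shiftTerm n r₁ r₂ Q d c N = 0 := by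
      intro N
      refine if_neg fun h => hg ?_
      have h1 : (Nat.gcd c d : ℤ) ∣ N :=
        (Int.natCast_dvd_natCast.2 (Nat.gcd_dvd_left c d)).trans h.1
      have h2 : (Nat.gcd c d : ℤ) ∣ n - N :=
        (Int.natCast_dvd_natCast.2 (Nat.gcd_dvd_right c d)).trans h.2
      simpa using h2.add h1
    simp [this, lcmLogTerm, shiftLogTerm, hg]

lemma abs_zpow_mul_tsum_le {Q : ℤ} (hQ : Q ≤ -2) {c d : ℕ} (hc : 0 < c) (hd : 0 < d) (b : ℤ) :
    |((c * d / Nat.gcd c d : ℕ) : ℝ) ^ Q * ∑' m : ℤ, ((m : ℝ) + uval c d b) ^ Q| ≤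
      (c : ℝ) ^ Q * ∑' k : ℤ, |(k : ℝ)| ^ Q := by
  have hg : 0 < Nat.gcd c d := Nat.gcd_pos_of_pos_left d hc
  have hdg : 0 < d / Nat.gcd c d := Nat.div_pos (Nat.gcd_le_right c hd) hg
  set i : ℤ → ℤ := fun m => b + ((d / Nat.gcd c d : ℕ) : ℤ) * m with hi
  have hinj : Function.Injective i := by
    intro x y hxy
    have hd' : ((d / Nat.gcd c d : ℕ) : ℤ) ≠ 0 := by exact_mod_cast hdg.ne'
    simpa only [hi, add_right_inj, mul_right_inj' hd'] using hxy
  have hs : Summable (fun k : ℤ => |(k : ℝ)| ^ Q) := by simpa using summable_add_zpow 0 hQ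
  have hterm : ∀ m : ℤ, ‖((c * d / Nat.gcd c d : ℕ) : ℝ) ^ Q * ((m : ℝ) + uval c d b) ^ Q‖ =
      (c : ℝ) ^ Q * |((i m : ℤ) : ℝ)| ^ Q := by
    intro m
    rw [← mul_zpow, natCast_mul_add_uval hc hd, norm_zpow, norm_mul, mul_zpow, mul_comm,
      Real.norm_eq_abs, Real.norm_eq_abs, Nat.abs_cast]
    simp only [hi, Int.cast_mul, Int.cast_add, Int.cast_natCast]
  have hs' : Summable (fun m : ℤ => (c : ℝ) ^ Q * |((i m : ℤ) : ℝ)| ^ Q) :=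
    (hs.comp_injective hinj).mul_left _
  rw [← tsum_mul_left, ← Real.norm_eq_abs]
  refine (norm_tsum_le_tsum_norm (hs'.congr fun m => (hterm m).symm)).trans ?_
  rw [tsum_congr hterm, tsum_mul_left]
  exact mul_le_mul_of_nonneg_left (tsum_comp_le_tsum_of_inj hs (fun _ => by positivity) hinj)
    (by positivity)

lemma norm_lcmLogTerm_le (n : ℤ) {r₂ : ℝ} {Q : ℤ} (hQ : (Q : ℝ) ≤ -3 - |r₂|)
    (bstar : ℕ → ℕ → ℤ) {d : ℕ} (hd : 0 < d) (c : ℕ) :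
    ‖lcmLogTerm n r₂ Q bstar d c‖ ≤
      (∑' k : ℤ, |(k : ℝ)| ^ Q) * ((c : ℝ) ^ (-2 : ℝ) + Real.log d * (c : ℝ) ^ (-3 : ℝ)) := by
  have hQ2 : Q ≤ -2 := by
    have : (Q : ℝ) ≤ -2 := by linarith [abs_nonneg r₂]
    exact_mod_cast this
  have hC : 0 ≤ ∑' k : ℤ, |(k : ℝ)| ^ Q := tsum_nonneg fun _ => by positivity
  have hld : 0 ≤ Real.log d := Real.log_natCast_nonneg d
  unfold lcmLogTerm
  split_ifs with h
  swap
  · rw [norm_zero]; positivity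
  obtain ⟨hc, -⟩ := h
  have hcR : (1 : ℝ) ≤ c := by exact_mod_cast hc
  have hc0 : (0 : ℝ) < c := by linarith
  have hd0 : (0 : ℝ) < d := by exact_mod_cast hd
  have hg : 0 < Nat.gcd c d := Nat.gcd_pos_of_pos_left d hc
  have hdg : 0 < d / Nat.gcd c d := Nat.div_pos (Nat.gcd_le_right c hd) hg
  have hM : 0 < c * d / Nat.gcd c d := by
    rw [Nat.mul_div_assoc _ (Nat.gcd_dvd_right c d)]; positivity
  have hlog : Real.log ((c * d / Nat.gcd c d : ℕ) : ℝ) ≤ c + Real.log d := by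
    have h1 : Real.log ((c * d / Nat.gcd c d : ℕ) : ℝ) ≤ Real.log ((c : ℝ) * d) := by
      refine Real.log_le_log (by exact_mod_cast hM) ?_
      exact_mod_cast Nat.div_le_self _ _
    rw [Real.log_mul hc0.ne' hd0.ne'] at h1
    linarith [Real.log_le_self hc0.le]
  have hZ := abs_zpow_mul_tsum_le hQ2 hc hd (bstar c d)
  set M := c * d / Nat.gcd c d
  set Z := ∑' m : ℤ, ((m : ℝ) + uval c d (bstar c d)) ^ Q
  have hlog0 : 0 ≤ Real.log (M : ℝ) := Real.log_natCast_nonneg M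
  have hcQ : (c : ℝ) ^ r₂ * (c : ℝ) ^ Q ≤ (c : ℝ) ^ (-3 : ℝ) := by
    rw [← Real.rpow_intCast, ← Real.rpow_add hc0]
    exact Real.rpow_le_rpow_of_exponent_le hcR (by linarith [le_abs_self r₂])
  calc ‖(c : ℂ) ^ (r₂ : ℂ) * (M : ℂ) ^ Q * (Real.log (M : ℝ) : ℂ) * (Z : ℂ)‖
      = (c : ℝ) ^ r₂ * |(M : ℝ) ^ Q * Z| * Real.log (M : ℝ) := by
        rw [norm_mul, norm_mul, norm_mul, Complex.norm_natCast_cpow_of_pos hc, Complex.ofReal_re,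
          norm_zpow, Complex.norm_natCast, Complex.norm_real, Complex.norm_real,
          Real.norm_of_nonneg hlog0, abs_mul, abs_of_nonneg (by positivity : 0 ≤ (M : ℝ) ^ Q),
          Real.norm_eq_abs]
        ring
    _ ≤ (c : ℝ) ^ r₂ * ((c : ℝ) ^ Q * ∑' k : ℤ, |(k : ℝ)| ^ Q) * (c + Real.log d) := by gcongr
    _ = ((c : ℝ) ^ r₂ * (c : ℝ) ^ Q) * (∑' k : ℤ, |(k : ℝ)| ^ Q) * (c + Real.log d) := by ring
    _ ≤ (c : ℝ) ^ (-3 : ℝ) * (∑' k : ℤ, |(k : ℝ)| ^ Q) * (c + Real.log d) := by gcongr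
    _ = _ := by
      have : (c : ℝ) ^ (-2 : ℝ) = (c : ℝ) ^ (-3 : ℝ) * c := by
        rw [← Real.rpow_add_one hc0.ne']; norm_num
      rw [this]; ring

lemma summable_cpow_mul_lcmLogTerm (n : ℤ) {r₁ : ℂ} (hr₁ : r₁.re < -1) {r₂ : ℝ} {Q : ℤ}
    (hQ : (Q : ℝ) ≤ -3 - |r₂|) (bstar : ℕ → ℕ → ℤ) :
    Summable (fun p : ℕ × ℕ => (p.1 : ℂ) ^ r₁ * lcmLogTerm n r₂ Q bstar p.1 p.2) := by
  have hC : 0 ≤ ∑' k : ℤ, |(k : ℝ)| ^ Q := tsum_nonneg fun _ => by positivity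
  set C := ∑' k : ℤ, |(k : ℝ)| ^ Q
  set ε := (-1 - r₁.re) / 2 with hε
  have hε0 : 0 < ε := by rw [hε]; linarith
  have h1 : Summable (fun d : ℕ => (d : ℝ) ^ r₁.re) := Real.summable_nat_rpow.2 hr₁
  have h2 : Summable (fun d : ℕ => (d : ℝ) ^ (r₁.re + ε) / ε) :=
    (Real.summable_nat_rpow.2 (by rw [hε]; linarith)).div_const _
  have h3 : Summable (fun c : ℕ => C * (c : ℝ) ^ (-2 : ℝ)) :=
    (Real.summable_nat_rpow.2 (by norm_num)).mul_left _
  have h4 : Summable (fun c : ℕ => C * (c : ℝ) ^ (-3 : ℝ)) :=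
    (Real.summable_nat_rpow.2 (by norm_num)).mul_left _
  refine Summable.of_norm_bounded
    ((h1.mul_of_nonneg h3 (fun _ => by positivity) (fun _ => by positivity)).add
      (h2.mul_of_nonneg h4 (fun _ => by positivity) (fun _ => by positivity))) ?_
  rintro ⟨d, c⟩
  dsimp only
  rcases Nat.eq_zero_or_pos d with rfl | hd
  · rw [Nat.cast_zero, Complex.zero_cpow (by rintro rfl; norm_num at hr₁), zero_mul, norm_zero]
    positivity
  have hd0 : (0 : ℝ) < d := by exact_mod_cast hd
  rw [norm_mul, Complex.norm_natCast_cpow_of_pos hd]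
  have hlog : Real.log d ≤ (d : ℝ) ^ ε / ε := Real.log_le_rpow_div hd0.le hε0
  calc _ ≤ (d : ℝ) ^ r₁.re *
        (C * ((c : ℝ) ^ (-2 : ℝ) + (d : ℝ) ^ ε / ε * (c : ℝ) ^ (-3 : ℝ))) := by
        gcongr
        refine (norm_lcmLogTerm_le n hQ bstar hd c).trans ?_
        gcongr
    _ = _ := by rw [Real.rpow_add hd0]; ring

lemma hasSum_int_of_parity {f : ℤ → ℂ} {A : ℂ} {Q : ℤ} (h0 : f 0 = 0)
    (hneg : ∀ k : ℕ, f (-k) = (-1) ^ Q * f k) (hA : HasSum (fun k : ℕ => f k) A) :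
    HasSum f (2 * (if 2 ∣ Q then (1 : ℂ) else 0) * A) := by
  have hA' : HasSum (fun k : ℕ => f (-k)) ((-1) ^ Q * A) := by
    simpa only [hneg] using hA.mul_left ((-1 : ℂ) ^ Q)
  suffices hval : 2 * (if 2 ∣ Q then (1 : ℂ) else 0) * A = A + (-1) ^ Q * A - f 0 by
    rw [hval]
    exact hA.of_nat_of_neg hA'
  split_ifs with h
  · rw [(even_iff_two_dvd.2 h).neg_one_zpow, h0]; ring
  · rw [(Int.not_even_iff_odd.1 (mt even_iff_two_dvd.1 h)).neg_one_zpow, h0]; ring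

lemma ofReal_tsum_int_zpow {Q : ℤ} (hQ : Q ≤ -2) :
    ((∑' m : ℤ, (m : ℝ) ^ Q : ℝ) : ℂ) =
      2 * (if 2 ∣ Q then (1 : ℂ) else 0) * riemannZeta (-(Q : ℂ)) := by
  have hre : 1 < (-(Q : ℂ)).re := by
    have : (Q : ℝ) ≤ -2 := by exact_mod_cast hQ
    simp; linarith
  have hterm : ∀ k : ℕ, 1 / (k : ℂ) ^ (-(Q : ℂ)) = ((k : ℤ) : ℂ) ^ Q := by
    intro k
    rw [← Int.cast_neg, Complex.cpow_intCast, zpow_neg, one_div, inv_inv, Int.cast_natCast]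
  have hs : HasSum (fun k : ℕ => ((k : ℤ) : ℂ) ^ Q) (riemannZeta (-(Q : ℂ))) := by
    rw [zeta_eq_tsum_one_div_nat_cpow hre, tsum_congr hterm]
    exact ((Complex.summable_one_div_nat_cpow.2 hre).congr hterm).hasSum
  rw [Complex.ofReal_tsum, ← (hasSum_int_of_parity (f := fun m : ℤ => (m : ℂ) ^ Q) (Q := Q)
    (by simp [zero_zpow Q (by omega)]) (fun k => ?_) hs).tsum_eq]
  · simp
  · push_cast
    rw [← mul_zpow, neg_one_mul]

lemma ofReal_tsum_int_zpow_mul_log {Q : ℤ} (hQ : Q ≤ -2) :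
    ((∑' m : ℤ, (m : ℝ) ^ Q * Real.log |(m : ℝ)| : ℝ) : ℂ) =
      2 * (if 2 ∣ Q then (1 : ℂ) else 0) * -deriv riemannZeta (-(Q : ℂ)) := by
  have hre : 1 < (-(Q : ℂ)).re := by
    have : (Q : ℝ) ≤ -2 := by exact_mod_cast hQ
    simp; linarith
  have habs : LSeries.abscissaOfAbsConv 1 < ((-(Q : ℂ)).re : EReal) := by
    rw [LSeries.abscissaOfAbsConv_one]; exact_mod_cast hre
  have hderiv : deriv riemannZeta (-(Q : ℂ)) = -LSeries (LSeries.logMul 1) (-(Q : ℂ)) := by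
    rw [← LSeries_deriv habs]
    refine Filter.EventuallyEq.deriv_eq ?_
    filter_upwards [(isOpen_lt continuous_const Complex.continuous_re).mem_nhds hre] with s hs
    exact (LSeries_one_eq_riemannZeta hs).symm
  have hterm : ∀ k : ℕ, LSeries.term (LSeries.logMul 1) (-(Q : ℂ)) k =
      ((k : ℤ) : ℂ) ^ Q * (Real.log |((k : ℤ) : ℝ)| : ℂ) := by
    intro k
    rcases eq_or_ne k 0 with rfl | hk
    · simp
    rw [LSeries.term_of_ne_zero hk, ← Int.cast_neg, Complex.cpow_intCast, zpow_neg, div_inv_eq_mul]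
    simp [LSeries.logMul, mul_comm]
  have hs : HasSum (fun k : ℕ => ((k : ℤ) : ℂ) ^ Q * (Real.log |((k : ℤ) : ℝ)| : ℂ))
      (-deriv riemannZeta (-(Q : ℂ))) := by
    rw [hderiv, neg_neg, LSeries, tsum_congr hterm]
    exact (Summable.congr (LSeriesSummable_logMul_of_lt_re habs) hterm).hasSum
  rw [Complex.ofReal_tsum, ← (hasSum_int_of_parity
    (f := fun m : ℤ => (m : ℂ) ^ Q * (Real.log |(m : ℝ)| : ℂ)) (Q := Q)
    (by simp) (fun k => ?_) hs).tsum_eq]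
  · simp
  · push_cast
    rw [← mul_assoc, ← mul_zpow, neg_one_mul, abs_neg]

lemma tsum_eq_sum_Icc_tsum {f : ℕ → ℂ} (hf : Summable f) (h0 : f 0 = 0) {d : ℕ} (hd : 0 < d) :
    ∑' c, f c = ∑ c' ∈ Finset.Icc 1 d, ∑' k, f (c' + d * k) := by
  obtain ⟨e, rfl⟩ := Nat.exists_eq_succ_of_ne_zero hd.ne'
  rw [hf.tsum_eq_zero_add, h0, zero_add,
    Nat.sumByResidueClasses ((summable_nat_add_iff 1).2 hf) (e + 1)]
  have h1 : ∑ j : ZMod (e + 1), ∑' k, f (j.val + (e + 1) * k + 1) =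
      ∑ j ∈ Finset.range (e + 1), ∑' k, f (j + (e + 1) * k + 1) :=
    Fin.sum_univ_eq_sum_range (fun j => ∑' k, f (j + (e + 1) * k + 1)) (e + 1)
  rw [h1]
  refine Finset.sum_nbij' (· + 1) (· - 1) ?_ ?_ ?_ ?_ fun j _ => tsum_congr fun k => ?_
  · intro j hj; simp at hj ⊢; omega
  · intro j hj; simp at hj ⊢; omega
  · intro j hj; simp
  · intro j hj; simp at hj ⊢; omega
  · rw [Nat.succ_eq_add_one, add_right_comm]

lemma tsum_shift_congr (F : ℝ → ℝ) {n : ℤ} {c c' d : ℕ} (hc : 0 < c) (hd : 0 < d)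
    (hcc : (d : ℤ) ∣ (c : ℤ) - c') (hg : Nat.gcd c d = Nat.gcd c' d) {a b a' b' : ℤ}
    (h : a * d - b * c = n) (h' : a' * d - b' * c' = n) :
    ∑' m : ℤ, F (m + uval c d b) = ∑' m : ℤ, F (m + uval c' d b') := by
  obtain ⟨e, he⟩ := hcc
  have hdvd : (d : ℤ) ∣ (b - b') * c :=
    ⟨a - a' - b' * e, by linear_combination h' - h - b' * he⟩
  obtain ⟨k, hk⟩ := (natCast_dvd_mul_natCast_iff hc _).1 hdvd
  have hg0 : (Nat.gcd c d : ℝ) ≠ 0 := by exact_mod_cast (Nat.gcd_pos_of_pos_left d hc).ne'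
  have hd0 : (d : ℝ) ≠ 0 := by exact_mod_cast hd.ne'
  have hu : uval c d b = k + uval c' d b' := by
    have hk' : (b : ℝ) - b' = (d : ℝ) / (Nat.gcd c d : ℝ) * k := by
      rw [← Nat.cast_div (Nat.gcd_dvd_right c d) hg0]
      rw [← Int.cast_sub, hk, Int.cast_mul, Int.cast_natCast]
    rw [uval, uval, ← hg]
    push_cast
    field_simp at hk' ⊢
    linear_combination hk'
  rw [hu, ← (Equiv.addRight k).tsum_eq (fun m : ℤ => F (m + uval c' d b'))]
  refine tsum_congr fun m => ?_
  simp [add_assoc]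

lemma natCast_cpow_mul_zpow_s3 {c : ℕ} (hc : 0 < c) (r : ℂ) (Q : ℤ) :
    (c : ℂ) ^ r * (c : ℂ) ^ Q = (c : ℂ) ^ (r + Q) := by
  rw [Complex.cpow_add _ _ (by exact_mod_cast hc.ne'), Complex.cpow_intCast]

lemma natCast_mul_div_gcd {c d : ℕ} (hc : 0 < c) :
    ((c * d / Nat.gcd c d : ℕ) : ℂ) = (c : ℂ) * d / (Nat.gcd c d : ℂ) := by
  rw [Nat.cast_div (Dvd.dvd.mul_right (Nat.gcd_dvd_left c d) d)
    (by exact_mod_cast (Nat.gcd_pos_of_pos_left d hc).ne'), Nat.cast_mul]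

lemma tsum_shiftLogTerm {n : ℤ} {r₂ : ℝ} {Q : ℤ} (hQ : (Q : ℝ) ≤ -3 - |r₂|)
    {bstar : ℕ → ℕ → ℤ}
    (hb : ∀ c d : ℕ, 0 < c → 0 < d → (Nat.gcd c d : ℤ) ∣ n → IsMinAbsB n c d (bstar c d))
    {d : ℕ} (hd : 0 < d) (hs : Summable (shiftLogTerm n r₂ Q bstar d)) :
    ∑' c, shiftLogTerm n r₂ Q bstar d c = (d : ℂ) ^ ((r₂ : ℂ) + 2 * (Q : ℂ)) *
      ∑ c' ∈ Finset.Icc 1 d, (if (Nat.gcd c' d : ℤ) ∣ n then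
        (Nat.gcd c' d : ℂ) ^ (-Q) * hzeta (-(r₂ : ℂ) - (Q : ℂ)) ((c' : ℝ) / d) *
          ((∑' m : ℤ, ((m : ℝ) + uval c' d (bstar c' d)) ^ Q *
            Real.log |(m : ℝ) + uval c' d (bstar c' d)| : ℝ) : ℂ) else 0) := by
  rw [tsum_eq_sum_Icc_tsum hs (by simp [shiftLogTerm]) hd, Finset.mul_sum]
  refine Finset.sum_congr rfl fun c' hc' => ?_
  obtain ⟨hc1, hcd⟩ := Finset.mem_Icc.1 hc'
  have hgcd : ∀ k, Nat.gcd (c' + d * k) d = Nat.gcd c' d := fun k => by simp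
  split_ifs with hg
  swap
  · simp [shiftLogTerm, hg]
  have hd0 : (0 : ℝ) < d := by exact_mod_cast hd
  set L := ∑' m : ℤ, ((m : ℝ) + uval c' d (bstar c' d)) ^ Q *
    Real.log |(m : ℝ) + uval c' d (bstar c' d)|
  set s : ℂ := -(r₂ : ℂ) - (Q : ℂ) with hsdef
  have hterm : ∀ k, shiftLogTerm n r₂ Q bstar d (c' + d * k) =
      ((d : ℂ) ^ ((r₂ : ℂ) + 2 * (Q : ℂ)) * (Nat.gcd c' d : ℂ) ^ (-Q) * L) *
        (1 / ((k : ℂ) + (((c' : ℝ) / d : ℝ) : ℂ)) ^ s) := by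
    intro k
    have hc : 0 < c' + d * k := by omega
    obtain ⟨⟨a, ha⟩, -⟩ := hb (c' + d * k) d hc hd (by rw [hgcd]; exact hg)
    obtain ⟨⟨a', ha'⟩, -⟩ := hb c' d hc1 hd hg
    have hL := tsum_shift_congr (fun x => x ^ Q * Real.log |x|) hc hd
      ⟨k, by push_cast; ring⟩ (hgcd k) ha ha'
    rw [shiftLogTerm, if_pos ⟨hc, by rw [hgcd]; exact hg⟩, hL, natCast_mul_div_gcd hc, hgcd,
      div_zpow, mul_zpow]
    have hck : ((c' + d * k : ℕ) : ℂ) = ((d : ℝ) : ℂ) * (((k : ℝ) + (c' : ℝ) / d : ℝ) : ℂ) := by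
      rw [← Complex.ofReal_mul, ← Complex.ofReal_natCast]
      congr 1
      push_cast
      field_simp
      ring
    have hpow : ((c' + d * k : ℕ) : ℂ) ^ (r₂ : ℂ) * ((c' + d * k : ℕ) : ℂ) ^ Q =
        (d : ℂ) ^ ((r₂ : ℂ) + Q) * (1 / ((k : ℂ) + (((c' : ℝ) / d : ℝ) : ℂ)) ^ s) := by
      rw [natCast_cpow_mul_zpow_s3 hc, hck, Complex.mul_cpow_ofReal_nonneg hd0.le (by positivity),
        one_div, ← Complex.cpow_neg, hsdef]
      push_cast
      congr 2
      ring
    have hdpow : (d : ℂ) ^ ((r₂ : ℂ) + 2 * (Q : ℂ)) = (d : ℂ) ^ ((r₂ : ℂ) + Q) * (d : ℂ) ^ Q := by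
      rw [natCast_cpow_mul_zpow_s3 hd]
      congr 1
      ring
    rw [hdpow, zpow_neg, div_eq_mul_inv]
    linear_combination (d : ℂ) ^ Q * ((Nat.gcd c' d : ℂ) ^ Q)⁻¹ * L * hpow
  have hz : HasSum (fun k : ℕ => 1 / ((k : ℂ) + (((c' : ℝ) / d : ℝ) : ℂ)) ^ s)
      (hzeta s ((c' : ℝ) / d)) := by
    refine HurwitzZeta.hasSum_hurwitzZeta_of_one_lt_re ⟨by positivity, ?_⟩ ?_
    · rw [div_le_one hd0]; exact_mod_cast hcd
    · simp [hsdef]; linarith [le_abs_self r₂]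
  rw [tsum_congr hterm, tsum_mul_left, hz.tsum_eq]
  ring

lemma tsum_eq_sum_divisors_add_tsum {n : ℤ} (hn : n ≠ 0) {h : ℕ → ℂ} (hs : Summable h)
    (h0 : h 0 = 0) :
    ∑' d, h d = ∑ d ∈ n.natAbs.divisors, h d +
      ∑' d : ℕ, if 0 < d ∧ ¬ (d : ℤ) ∣ n then h d else 0 := by
  rw [← hs.sum_add_tsum_compl (s := n.natAbs.divisors), tsum_subtype]
  congr 1
  refine tsum_congr fun d => ?_
  have hmem : d ∈ (↑n.natAbs.divisors : Set ℕ)ᶜ ↔ ¬ (d : ℤ) ∣ n := by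
    simp [Int.natCast_dvd, hn]
  rcases Nat.eq_zero_or_pos d with rfl | hd
  · simp [h0]
  · simp only [Set.indicator_apply, hmem, hd, true_and]

lemma summable_ite_of_summable {h : ℕ → ℂ} (hs : Summable h) (P : ℕ → Prop) [DecidablePred P] :
    Summable (fun d => if P d then h d else 0) := by
  refine Summable.of_norm_bounded hs.norm fun d => ?_
  split_ifs <;> simp

lemma uval_zero (c d : ℕ) : uval c d 0 = 0 := by simp [uval]

lemma IsMinAbsB.eq_zero {n : ℤ} {c d : ℕ} {b : ℤ} (h : IsMinAbsB n c d b) (hd : (d : ℤ) ∣ n) :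
    b = 0 := by
  obtain ⟨a, rfl⟩ := hd
  simpa using h.2 0 ⟨a, by ring⟩

lemma lcmLogTerm_eq_of_dvd {n : ℤ} (r₂ : ℝ) {Q : ℤ} (hQ : Q ≤ -2) {bstar : ℕ → ℕ → ℤ}
    (hb : ∀ c d : ℕ, 0 < c → 0 < d → (Nat.gcd c d : ℤ) ∣ n → IsMinAbsB n c d (bstar c d))
    {d : ℕ} (hd : 0 < d) (hdn : (d : ℤ) ∣ n) (c : ℕ) :
    lcmLogTerm n r₂ Q bstar d c =
      (2 * (if 2 ∣ Q then (1 : ℂ) else 0) * riemannZeta (-(Q : ℂ)) * (d : ℂ) ^ Q) *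
      ((if 0 < c then (c : ℂ) ^ ((r₂ : ℂ) + (Q : ℂ)) * (Nat.gcd c d : ℂ) ^ (-Q) *
          ((Real.log c - Real.log (Nat.gcd c d) : ℝ) : ℂ) else 0) +
        (Real.log d : ℂ) * (if 0 < c then (c : ℂ) ^ ((r₂ : ℂ) + (Q : ℂ)) *
          (Nat.gcd c d : ℂ) ^ (-Q) else 0)) := by
  rcases Nat.eq_zero_or_pos c with rfl | hc
  · simp [lcmLogTerm]
  have hg : (Nat.gcd c d : ℤ) ∣ n :=
    (Int.natCast_dvd_natCast.2 (Nat.gcd_dvd_right c d)).trans hdn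
  have hg0 : (Nat.gcd c d : ℝ) ≠ 0 := by exact_mod_cast (Nat.gcd_pos_of_pos_left d hc).ne'
  have hc0 : (c : ℝ) ≠ 0 := by exact_mod_cast hc.ne'
  have hd0 : (d : ℝ) ≠ 0 := by exact_mod_cast hd.ne'
  have hlog : Real.log ((c * d / Nat.gcd c d : ℕ) : ℝ) =
      Real.log c - Real.log (Nat.gcd c d) + Real.log d := by
    rw [Nat.cast_div (Dvd.dvd.mul_right (Nat.gcd_dvd_left c d) d) hg0, Nat.cast_mul,
      Real.log_div (mul_ne_zero hc0 hd0) hg0, Real.log_mul hc0 hd0]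
    ring
  rw [lcmLogTerm, if_pos ⟨hc, hg⟩, if_pos hc, if_pos hc, (hb c d hc hd hg).eq_zero hdn, uval_zero,
    hlog, natCast_mul_div_gcd hc, div_zpow, mul_zpow, ← natCast_cpow_mul_zpow_s3 hc]
  simp only [add_zero]
  rw [ofReal_tsum_int_zpow hQ, zpow_neg, div_eq_mul_inv]
  push_cast
  ring

lemma shiftLogTerm_eq_of_dvd {n : ℤ} (r₂ : ℝ) {Q : ℤ} (hQ : Q ≤ -2) {bstar : ℕ → ℕ → ℤ}
    (hb : ∀ c d : ℕ, 0 < c → 0 < d → (Nat.gcd c d : ℤ) ∣ n → IsMinAbsB n c d (bstar c d))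
    {d : ℕ} (hd : 0 < d) (hdn : (d : ℤ) ∣ n) (c : ℕ) :
    shiftLogTerm n r₂ Q bstar d c =
      (2 * (if 2 ∣ Q then (1 : ℂ) else 0) * -deriv riemannZeta (-(Q : ℂ)) * (d : ℂ) ^ Q) *
      (if 0 < c then (c : ℂ) ^ ((r₂ : ℂ) + (Q : ℂ)) * (Nat.gcd c d : ℂ) ^ (-Q) else 0) := by
  rcases Nat.eq_zero_or_pos c with rfl | hc
  · simp [shiftLogTerm]
  have hg : (Nat.gcd c d : ℤ) ∣ n :=
    (Int.natCast_dvd_natCast.2 (Nat.gcd_dvd_right c d)).trans hdn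
  rw [shiftLogTerm, if_pos ⟨hc, hg⟩, if_pos hc, (hb c d hc hd hg).eq_zero hdn, uval_zero,
    natCast_mul_div_gcd hc, div_zpow, mul_zpow, ← natCast_cpow_mul_zpow_s3 hc]
  simp only [add_zero]
  rw [ofReal_tsum_int_zpow_mul_log hQ, zpow_neg, div_eq_mul_inv]
  ring

lemma summable_cpow_mul_gcd_zpow {r₂ : ℝ} {Q : ℤ} (hQ : (Q : ℝ) ≤ -3 - |r₂|) {d : ℕ}
    (hd : 0 < d) :
    Summable (fun c : ℕ => if 0 < c then (c : ℂ) ^ ((r₂ : ℂ) + (Q : ℂ)) *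
          (Nat.gcd c d : ℂ) ^ (-Q) *
          ((Real.log c - Real.log (Nat.gcd c d) : ℝ) : ℂ) else 0) ∧
      Summable (fun c : ℕ => if 0 < c then (c : ℂ) ^ ((r₂ : ℂ) + (Q : ℂ)) *
          (Nat.gcd c d : ℂ) ^ (-Q) else 0) := by
  have hQ0 : 0 ≤ -Q := by
    have : (Q : ℝ) ≤ 0 := by linarith [abs_nonneg r₂]
    have : Q ≤ 0 := by exact_mod_cast this
    omega
  have hmain : ∀ c : ℕ, 0 < c → ‖(c : ℂ) ^ ((r₂ : ℂ) + (Q : ℂ)) * (Nat.gcd c d : ℂ) ^ (-Q)‖ ≤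
      (d : ℝ) ^ (-Q) * (c : ℝ) ^ (-3 : ℝ) := by
    intro c hc
    have hcR : (1 : ℝ) ≤ c := by exact_mod_cast hc
    rw [norm_mul, Complex.norm_natCast_cpow_of_pos hc, norm_zpow, Complex.norm_natCast, mul_comm]
    have hgd : (Nat.gcd c d : ℝ) ≤ d := by exact_mod_cast Nat.gcd_le_right c hd
    have hre : ((r₂ : ℂ) + (Q : ℂ)).re ≤ -3 := by
      simp; linarith [le_abs_self r₂]
    gcongr
    · exact zpow_le_zpow_left₀ hQ0 (by positivity) hgd
  have hs : ∀ e : ℝ, e < -1 → Summable (fun c : ℕ => (d : ℝ) ^ (-Q) * (c : ℝ) ^ e) := fun e he =>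
    (Real.summable_nat_rpow.2 he).mul_left _
  constructor
  · refine Summable.of_norm_bounded (hs (-2) (by norm_num)) fun c => ?_
    split_ifs with hc
    swap
    · rw [norm_zero]; positivity
    have hc0 : (0 : ℝ) < c := by exact_mod_cast hc
    have hg := Nat.gcd_pos_of_pos_left d hc
    have hgc : Real.log (Nat.gcd c d) ≤ Real.log c :=
      Real.log_le_log (by exact_mod_cast hg) (by exact_mod_cast Nat.gcd_le_left d hc)
    have hl : ‖((Real.log c - Real.log (Nat.gcd c d) : ℝ) : ℂ)‖ ≤ c := by
      rw [Complex.norm_real, Real.norm_of_nonneg (by linarith)]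
      linarith [Real.log_le_self hc0.le, Real.log_natCast_nonneg (Nat.gcd c d)]
    have h3 : (c : ℝ) ^ (-2 : ℝ) = (c : ℝ) ^ (-3 : ℝ) * c := by
      rw [← Real.rpow_add_one hc0.ne']; norm_num
    rw [norm_mul, h3, ← mul_assoc]
    exact mul_le_mul (hmain c hc) hl (norm_nonneg _) (by positivity)
  · refine Summable.of_norm_bounded (hs (-3) (by norm_num)) fun c => ?_
    split_ifs with hc
    · exact hmain c hc
    · rw [norm_zero]; positivity

/-- Theorem 1.2 of the paper (exact evaluation of the shifted convolution sum
`∑_{n₁+n₂=n} σ_{r₁}(n₁)·σ_{r₂}(n₂)·n₂^Q·log|n₂|`), with all sums converging absolutely. -/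
theorem shifted_convolution_log (n : ℤ) (hn : n ≠ 0) (r₂ : ℝ) (r₁ : ℂ)
    (hr₁ : r₁.re < -1) (Q : ℤ) (hQ : (Q : ℝ) ≤ -3 - |r₂|)
    (bstar : ℕ → ℕ → ℤ)
    (hb : ∀ c d : ℕ, 0 < c → 0 < d → (Nat.gcd c d : ℤ) ∣ n →
      IsMinAbsB n c d (bstar c d)) :
    -- absolute convergence of the shifted convolution sum
    Summable (fun m : ℤ => if m ≠ 0 ∧ n - m ≠ 0 then
        dsigma r₁ m * dsigma (r₂ : ℂ) (n - m) * ((n - m : ℤ) : ℂ) ^ Q *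
          (Real.log |((n - m : ℤ) : ℝ)| : ℂ) else 0) ∧
    -- absolute convergence of the two Dirichlet-type sums over c
    (∀ d : ℕ, 0 < d →
      Summable (fun c : ℕ => if 0 < c then (c : ℂ) ^ ((r₂ : ℂ) + (Q : ℂ)) *
          (Nat.gcd c d : ℂ) ^ (-Q) *
          ((Real.log c - Real.log (Nat.gcd c d) : ℝ) : ℂ) else 0) ∧
      Summable (fun c : ℕ => if 0 < c then (c : ℂ) ^ ((r₂ : ℂ) + (Q : ℂ)) *
          (Nat.gcd c d : ℂ) ^ (-Q) else 0)) ∧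
    -- absolute convergence of the bilateral sums over m
    (∀ c d : ℕ, 0 < c → 0 < d → ¬ (d : ℤ) ∣ n → (Nat.gcd c d : ℤ) ∣ n →
      Summable (fun m : ℤ => ((m : ℝ) + uval c d (bstar c d)) ^ Q) ∧
      Summable (fun m : ℤ =>
        ((m : ℝ) + uval c d (bstar c d)) ^ Q * Real.log |(m : ℝ) + uval c d (bstar c d)|)) ∧
    -- absolute convergence of the inner c-sum of the fourth term
    (∀ d : ℕ, 0 < d → ¬ (d : ℤ) ∣ n →
      Summable (fun c : ℕ => if 0 < c ∧ (Nat.gcd c d : ℤ) ∣ n then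
        (c : ℂ) ^ (r₂ : ℂ) * ((c * d / Nat.gcd c d : ℕ) : ℂ) ^ Q *
          (Real.log ((c * d / Nat.gcd c d : ℕ) : ℝ) : ℂ) *
          ((∑' m : ℤ, ((m : ℝ) + uval c d (bstar c d)) ^ Q : ℝ) : ℂ) else 0)) ∧
    -- absolute convergence of the outer d-sums of the fourth and fifth terms
    Summable (fun d : ℕ => if 0 < d ∧ ¬ (d : ℤ) ∣ n then
        (d : ℂ) ^ r₁ * ∑' c : ℕ, (if 0 < c ∧ (Nat.gcd c d : ℤ) ∣ n then
          (c : ℂ) ^ (r₂ : ℂ) * ((c * d / Nat.gcd c d : ℕ) : ℂ) ^ Q *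
            (Real.log ((c * d / Nat.gcd c d : ℕ) : ℝ) : ℂ) *
            ((∑' m : ℤ, ((m : ℝ) + uval c d (bstar c d)) ^ Q : ℝ) : ℂ) else 0)
      else 0) ∧
    Summable (fun d : ℕ => if 0 < d ∧ ¬ (d : ℤ) ∣ n then
        (d : ℂ) ^ (r₁ + (r₂ : ℂ) + 2 * (Q : ℂ)) *
          ∑ c' ∈ Finset.Icc 1 d, (if (Nat.gcd c' d : ℤ) ∣ n then
            (Nat.gcd c' d : ℂ) ^ (-Q) * hzeta (-(r₂ : ℂ) - (Q : ℂ)) ((c' : ℝ) / d) *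
              ((∑' m : ℤ, ((m : ℝ) + uval c' d (bstar c' d)) ^ Q *
                Real.log |(m : ℝ) + uval c' d (bstar c' d)| : ℝ) : ℂ) else 0)
      else 0) ∧
    -- the identity
    (∑' m : ℤ, if m ≠ 0 ∧ n - m ≠ 0 then
        dsigma r₁ m * dsigma (r₂ : ℂ) (n - m) * ((n - m : ℤ) : ℂ) ^ Q *
          (Real.log |((n - m : ℤ) : ℝ)| : ℂ) else 0) =
      - riemannZeta (-r₁) * dsigma (r₂ : ℂ) n * (n : ℂ) ^ Q * (Real.log |(n : ℝ)| : ℂ)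
      + (-1 : ℂ) ^ Q * 2 * (if 2 ∣ Q then (1 : ℂ) else 0) * riemannZeta (-(Q : ℂ)) *
          (∑ d ∈ n.natAbs.divisors, (d : ℂ) ^ ((Q : ℂ) + r₁) *
            ∑' c : ℕ, (if 0 < c then (c : ℂ) ^ ((r₂ : ℂ) + (Q : ℂ)) *
              (Nat.gcd c d : ℂ) ^ (-Q) *
              ((Real.log c - Real.log (Nat.gcd c d) : ℝ) : ℂ) else 0))
      + (-1 : ℂ) ^ Q * 2 * (if 2 ∣ Q then (1 : ℂ) else 0) *
          (∑ d ∈ n.natAbs.divisors, (d : ℂ) ^ ((Q : ℂ) + r₁) *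
            ((Real.log d : ℂ) * riemannZeta (-(Q : ℂ)) - deriv riemannZeta (-(Q : ℂ))) *
            ∑' c : ℕ, (if 0 < c then (c : ℂ) ^ ((r₂ : ℂ) + (Q : ℂ)) *
              (Nat.gcd c d : ℂ) ^ (-Q) else 0))
      + (-1 : ℂ) ^ Q *
          ∑' d : ℕ, (if 0 < d ∧ ¬ (d : ℤ) ∣ n then
            (d : ℂ) ^ r₁ * ∑' c : ℕ, (if 0 < c ∧ (Nat.gcd c d : ℤ) ∣ n then
              (c : ℂ) ^ (r₂ : ℂ) * ((c * d / Nat.gcd c d : ℕ) : ℂ) ^ Q *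
                (Real.log ((c * d / Nat.gcd c d : ℕ) : ℝ) : ℂ) *
                ((∑' m : ℤ, ((m : ℝ) + uval c d (bstar c d)) ^ Q : ℝ) : ℂ) else 0)
          else 0)
      + (-1 : ℂ) ^ Q *
          ∑' d : ℕ, (if 0 < d ∧ ¬ (d : ℤ) ∣ n then
            (d : ℂ) ^ (r₁ + (r₂ : ℂ) + 2 * (Q : ℂ)) *
              ∑ c' ∈ Finset.Icc 1 d, (if (Nat.gcd c' d : ℤ) ∣ n then
                (Nat.gcd c' d : ℂ) ^ (-Q) * hzeta (-(r₂ : ℂ) - (Q : ℂ)) ((c' : ℝ) / d) *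
                  ((∑' m : ℤ, ((m : ℝ) + uval c' d (bstar c' d)) ^ Q *
                    Real.log |(m : ℝ) + uval c' d (bstar c' d)| : ℝ) : ℂ) else 0)
          else 0) := by
  have hQ3 : Q ≤ -3 := by
    have : (Q : ℝ) ≤ -3 := by linarith [abs_nonneg r₂]
    exact_mod_cast this
  have hr₁0 : r₁ ≠ 0 := by rintro rfl; norm_num at hr₁
  have hK := summable_shiftTerm n hr₁ hQ
  have hA := summable_cpow_mul_lcmLogTerm n hr₁ hQ bstar
  have hS : ∀ p : ℕ × ℕ, ∑' N : ℤ, shiftTerm n r₁ r₂ Q p.1 p.2 N = (-1) ^ Q *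
      ((p.1 : ℂ) ^ r₁ * lcmLogTerm n r₂ Q bstar p.1 p.2 +
        (p.1 : ℂ) ^ r₁ * shiftLogTerm n r₂ Q bstar p.1 p.2) :=
    fun p => tsum_shiftTerm hr₁0 r₂ hQ3 hb p.1 p.2
  have hsq : (-1 : ℂ) ^ Q ≠ 0 := zpow_ne_zero _ (by norm_num)
  have hB : Summable
      (fun p : ℕ × ℕ => (p.1 : ℂ) ^ r₁ * shiftLogTerm n r₂ Q bstar p.1 p.2) := by
    have h := (summable_mul_left_iff hsq).1 (hK.prod.congr hS)
    exact (h.sub hA).congr fun p => by ring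
  have hd_ne : ∀ d : ℕ, 0 < d → (d : ℂ) ^ r₁ ≠ 0 := fun d hd => by
    rw [Complex.cpow_ne_zero_iff_of_exponent_ne_zero hr₁0]; exact_mod_cast hd.ne'
  have hA1 : ∀ d : ℕ, 0 < d → Summable (lcmLogTerm n r₂ Q bstar d) := fun d hd =>
    (summable_mul_left_iff (hd_ne d hd)).1 (hA.prod_factor d)
  have hB1 : ∀ d : ℕ, 0 < d → Summable (shiftLogTerm n r₂ Q bstar d) := fun d hd =>
    (summable_mul_left_iff (hd_ne d hd)).1 (hB.prod_factor d)
  have hA2 : Summable (fun d : ℕ => (d : ℂ) ^ r₁ * ∑' c, lcmLogTerm n r₂ Q bstar d c) :=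
    hA.prod.congr fun d => by simp only [tsum_mul_left]
  have hB2 : Summable (fun d : ℕ => (d : ℂ) ^ r₁ * ∑' c, shiftLogTerm n r₂ Q bstar d c) :=
    hB.prod.congr fun d => by simp only [tsum_mul_left]
  have hB3 : ∀ d : ℕ, (if 0 < d ∧ ¬ (d : ℤ) ∣ n then
        (d : ℂ) ^ r₁ * ∑' c, shiftLogTerm n r₂ Q bstar d c else 0) =
      if 0 < d ∧ ¬ (d : ℤ) ∣ n then
        (d : ℂ) ^ (r₁ + (r₂ : ℂ) + 2 * (Q : ℂ)) *
          ∑ c' ∈ Finset.Icc 1 d, (if (Nat.gcd c' d : ℤ) ∣ n then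
            (Nat.gcd c' d : ℂ) ^ (-Q) * hzeta (-(r₂ : ℂ) - (Q : ℂ)) ((c' : ℝ) / d) *
              ((∑' m : ℤ, ((m : ℝ) + uval c' d (bstar c' d)) ^ Q *
                Real.log |(m : ℝ) + uval c' d (bstar c' d)| : ℝ) : ℂ) else 0)
      else 0 := by
    intro d
    split_ifs with hd
    · rw [tsum_shiftLogTerm hQ hb hd.1 (hB1 d hd.1), add_assoc r₁,
        Complex.cpow_add r₁ _ (by exact_mod_cast hd.1.ne'), mul_assoc]
    · rfl
  set G : ℤ → ℂ := fun N => if n - N ≠ 0 ∧ N ≠ 0 then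
    dsigma r₁ (n - N) * dsigma (r₂ : ℂ) N * (N : ℂ) ^ Q * (Real.log |(N : ℝ)| : ℂ) else 0
    with hG
  set W : ℂ := riemannZeta (-r₁) * dsigma (r₂ : ℂ) n * (n : ℂ) ^ Q * (Real.log |(n : ℝ)| : ℂ)
  have hN : ∀ N, ∑' p : ℕ × ℕ, shiftTerm n r₁ r₂ Q p.1 p.2 N = G N + if N = n then W else 0 :=
    tsum_shiftTerm_divisors n hr₁ r₂ Q
  have hGW : Summable (fun N => G N + if N = n then W else 0) :=
    ((Equiv.prodComm _ _).summable_iff.2 hK).prod.congr hN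
  have hWs : HasSum (fun N : ℤ => if N = n then W else 0) W := hasSum_ite_eq n W
  have hGs : Summable G := (hGW.sub hWs.summable).congr fun N => by simp
  have hrefl : ∀ m : ℤ, G (Equiv.subLeft n m) = if m ≠ 0 ∧ n - m ≠ 0 then
      dsigma r₁ m * dsigma (r₂ : ℂ) (n - m) * ((n - m : ℤ) : ℂ) ^ Q *
        (Real.log |((n - m : ℤ) : ℝ)| : ℂ) else 0 := by
    intro m
    simp only [hG, Equiv.subLeft_apply, sub_sub_cancel]
  have hGS : ∑' N, G N + W = (-1) ^ Q *
      ((∑' d : ℕ, (d : ℂ) ^ r₁ * ∑' c, lcmLogTerm n r₂ Q bstar d c) +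
        ∑' d : ℕ, (d : ℂ) ^ r₁ * ∑' c, shiftLogTerm n r₂ Q bstar d c) := by
    rw [← hWs.tsum_eq, ← hGs.tsum_add hWs.summable, ← tsum_congr hN,
      Summable.tsum_comm (f := fun (p : ℕ × ℕ) (N : ℤ) => shiftTerm n r₁ r₂ Q p.1 p.2 N) hK,
      tsum_congr hS, tsum_mul_left, hA.tsum_add hB, hA.tsum_prod, hB.tsum_prod]
    simp only [tsum_mul_left]
  have hdiv : ∀ d ∈ n.natAbs.divisors, 0 < d ∧ (d : ℤ) ∣ n := fun d hd =>
    ⟨Nat.pos_of_mem_divisors hd, Int.natCast_dvd.2 (Nat.dvd_of_mem_divisors hd)⟩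
  refine ⟨(((Equiv.subLeft n).summable_iff.2 hGs).congr hrefl),
    fun d hd => summable_cpow_mul_gcd_zpow hQ hd, fun c d _ _ _ _ => ⟨?_, ?_⟩,
    fun d hd _ => hA1 d hd, summable_ite_of_summable hA2 _,
    (summable_ite_of_summable hB2 _).congr hB3, ?_⟩
  · exact Summable.of_norm (by simpa using summable_add_zpow (uval c d (bstar c d)) (by omega))
  · exact summable_add_zpow_mul_log _ hQ3
  rw [← tsum_congr hrefl, (Equiv.subLeft n).tsum_eq G, eq_sub_of_add_eq hGS,
    tsum_eq_sum_divisors_add_tsum hn hA2 (by simp [Complex.zero_cpow hr₁0]),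
    tsum_eq_sum_divisors_add_tsum hn hB2 (by simp [Complex.zero_cpow hr₁0]), tsum_congr hB3]
  have hfin : ∑ d ∈ n.natAbs.divisors, (d : ℂ) ^ r₁ * ∑' c, lcmLogTerm n r₂ Q bstar d c +
      ∑ d ∈ n.natAbs.divisors, (d : ℂ) ^ r₁ * ∑' c, shiftLogTerm n r₂ Q bstar d c =
      2 * (if 2 ∣ Q then (1 : ℂ) else 0) * riemannZeta (-(Q : ℂ)) *
          (∑ d ∈ n.natAbs.divisors, (d : ℂ) ^ ((Q : ℂ) + r₁) *
            ∑' c : ℕ, (if 0 < c then (c : ℂ) ^ ((r₂ : ℂ) + (Q : ℂ)) *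
              (Nat.gcd c d : ℂ) ^ (-Q) *
              ((Real.log c - Real.log (Nat.gcd c d) : ℝ) : ℂ) else 0))
      + 2 * (if 2 ∣ Q then (1 : ℂ) else 0) *
          (∑ d ∈ n.natAbs.divisors, (d : ℂ) ^ ((Q : ℂ) + r₁) *
            ((Real.log d : ℂ) * riemannZeta (-(Q : ℂ)) - deriv riemannZeta (-(Q : ℂ))) *
            ∑' c : ℕ, (if 0 < c then (c : ℂ) ^ ((r₂ : ℂ) + (Q : ℂ)) *
              (Nat.gcd c d : ℂ) ^ (-Q) else 0)) := by
    rw [Finset.mul_sum, Finset.mul_sum, ← Finset.sum_add_distrib, ← Finset.sum_add_distrib]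
    refine Finset.sum_congr rfl fun d hd => ?_
    obtain ⟨hd0, hdn⟩ := hdiv d hd
    obtain ⟨hX, hY⟩ := summable_cpow_mul_gcd_zpow hQ hd0
    rw [tsum_congr (lcmLogTerm_eq_of_dvd r₂ (by omega) hb hd0 hdn),
      tsum_congr (shiftLogTerm_eq_of_dvd r₂ (by omega) hb hd0 hdn), tsum_mul_left, tsum_mul_left,
      hX.tsum_add (hY.mul_left _), tsum_mul_left, add_comm (Q : ℂ) r₁,
      ← natCast_cpow_mul_zpow_s3 hd0]
    ring
  simp only [lcmLogTerm] at hfin ⊢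
  linear_combination (-1 : ℂ) ^ Q * hfin
end

section
/- Let n be a nonzero integer, d a positive integer with d ∣ n, r₂ ∈ ℝ, and P ∈ ℤ with P ≤ −3 − |r₂|. Then the following sums converge absolutely and ∑_{c∈ℕ} c^{r₂} ∑_{a,b∈ℤ∖{0}, ad−bc=n} (bc)^P = (−1)^{P+1}·n^P·σ_{r₂}(n) + 2·δ_{2∣P}·d^P·ζ(−P)·ζ(−r₂−P)·∏_{p∣d, p prime} (1 + (1−p^P)·(p^{r₂} + p^{2r₂} + ⋯ + p^{v_p(d)·r₂})). -/
open scoped BigOperators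

theorem HasSum.of_eq {ι : Type*} {f g : ι → ℂ} {a b : ℂ} (h : HasSum f a)
    (hfg : ∀ i, g i = f i) (hab : b = a) : HasSum g b := by
  rwa [funext hfg, hab]

theorem HasSum.summable_and_tsum_eq {ι : Type*} {f : ι → ℂ} {a : ℂ} (h : HasSum f a) :
    Summable f ∧ ∑' i, f i = a :=
  ⟨h.summable, h.tsum_eq⟩

/-- Jordan's totient function `J_Q = μ * (m ↦ m ^ Q)`, with complex values. -/
noncomputable def jordanTotient (Q : ℕ) : ArithmeticFunction ℂ :=
  ((ArithmeticFunction.moebius : ArithmeticFunction ℤ) : ArithmeticFunction ℂ) *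
    ((ArithmeticFunction.pow Q : ArithmeticFunction ℕ) : ArithmeticFunction ℂ)

theorem isMultiplicative_jordanTotient (Q : ℕ) : (jordanTotient Q).IsMultiplicative :=
  ArithmeticFunction.isMultiplicative_moebius.intCast.mul
    ArithmeticFunction.isMultiplicative_pow.natCast

theorem sum_divisors_jordanTotient {Q : ℕ} (hQ : Q ≠ 0) (m : ℕ) :
    ∑ e ∈ m.divisors, jordanTotient Q e = (m : ℂ) ^ Q := by
  rw [← ArithmeticFunction.coe_zeta_mul_apply, jordanTotient, ← mul_assoc,
    ArithmeticFunction.coe_zeta_mul_coe_moebius, one_mul, ArithmeticFunction.natCoe_apply,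
    ArithmeticFunction.pow_apply]
  simp [hQ]

theorem jordanTotient_prime_pow_succ {Q p : ℕ} (hQ : Q ≠ 0) (hp : p.Prime) (k : ℕ) :
    jordanTotient Q (p ^ (k + 1)) = ((p : ℂ) ^ Q) ^ (k + 1) - ((p : ℂ) ^ Q) ^ k := by
  have h := sum_divisors_jordanTotient hQ (p ^ (k + 1))
  have h' := sum_divisors_jordanTotient hQ (p ^ k)
  rw [Nat.sum_divisors_prime_pow hp] at h h'
  rw [Finset.sum_range_succ, h'] at h
  push_cast at h
  rw [pow_right_comm (p : ℂ) Q, pow_right_comm (p : ℂ) Q, ← h]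
  ring

/-- The arithmetic function `m ↦ J_Q(m) m ^ (-s)`. -/
noncomputable def jordanTwist (Q : ℕ) (s : ℂ) : ArithmeticFunction ℂ :=
  ⟨fun m => jordanTotient Q m * (m : ℂ) ^ (-s), by simp⟩

theorem jordanTwist_apply (Q : ℕ) (s : ℂ) (m : ℕ) :
    jordanTwist Q s m = jordanTotient Q m * (m : ℂ) ^ (-s) := rfl

theorem isMultiplicative_jordanTwist (Q : ℕ) (s : ℂ) : (jordanTwist Q s).IsMultiplicative := by
  have hJ := isMultiplicative_jordanTotient Q
  refine ⟨by simp [jordanTwist_apply, hJ.map_one], fun {m n} hmn => ?_⟩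
  rw [jordanTwist_apply, jordanTwist_apply, jordanTwist_apply, hJ.map_mul_of_coprime hmn,
    Nat.cast_mul, Complex.natCast_mul_natCast_cpow]
  ring

theorem jordanTwist_prime_pow_succ {Q p : ℕ} (hQ : Q ≠ 0) (hp : p.Prime) (s : ℂ) (k : ℕ) :
    jordanTwist Q s (p ^ (k + 1)) =
      (1 - (p : ℂ) ^ (-(Q : ℤ))) * (p : ℂ) ^ (((k + 1 : ℕ) : ℂ) * (Q - s)) := by
  have hp0 : (p : ℂ) ≠ 0 := by exact_mod_cast hp.ne_zero
  rw [jordanTwist_apply, jordanTotient_prime_pow_succ hQ hp, sub_eq_add_neg (Q : ℂ), mul_add,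
    Complex.cpow_add _ _ hp0, Complex.natCast_cpow_natCast_mul p (k + 1) (-s), Nat.cast_pow,
    ← Nat.cast_mul, Complex.cpow_natCast, zpow_neg, zpow_natCast, mul_comm (k + 1) Q, pow_mul,
    pow_succ ((p : ℂ) ^ Q) k]
  have : (p : ℂ) ^ Q ≠ 0 := pow_ne_zero _ hp0
  field_simp

theorem sum_divisors_jordanTwist {Q d : ℕ} (hQ : Q ≠ 0) (hd : d ≠ 0) (s : ℂ) :
    ∑ e ∈ d.divisors, jordanTwist Q s e =
      ∏ p ∈ d.primeFactors, (1 + (1 - (p : ℂ) ^ (-(Q : ℤ))) *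
        ∑ j ∈ Finset.Icc 1 (d.factorization p), (p : ℂ) ^ ((j : ℂ) * (Q - s))) := by
  have hT := isMultiplicative_jordanTwist Q s
  rw [← ArithmeticFunction.coe_zeta_mul_apply,
    (ArithmeticFunction.isMultiplicative_zeta.natCast.mul hT).multiplicative_factorization _ hd,
    Finsupp.prod, Nat.support_factorization]
  refine Finset.prod_congr rfl fun p hp => ?_
  have hp := Nat.prime_of_mem_primeFactors hp
  rw [ArithmeticFunction.coe_zeta_mul_apply, Nat.sum_divisors_prime_pow hp,
    Finset.sum_range_succ', pow_zero, hT.map_one, add_comm, Finset.mul_sum,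
    Finset.range_eq_Ico, Finset.sum_Ico_add' (fun j => jordanTwist Q s (p ^ j)), zero_add,
    Finset.Ico_add_one_right_eq_Icc]
  congr 1
  refine Finset.sum_congr rfl fun j hj => ?_
  obtain ⟨k, rfl⟩ := Nat.exists_eq_succ_of_ne_zero
    (Nat.one_le_iff_ne_zero.mp (Finset.mem_Icc.mp hj).1)
  exact jordanTwist_prime_pow_succ hQ hp s k

theorem hasSum_natCast_cpow_neg {s : ℂ} (hs : 1 < s.re) :
    HasSum (fun c : ℕ => (c : ℂ) ^ (-s)) (riemannZeta s) := by
  rw [zeta_eq_tsum_one_div_nat_cpow hs]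
  simpa only [one_div, Complex.cpow_neg] using (Complex.summable_one_div_nat_cpow.mpr hs).hasSum

/-- The Dirichlet series over the multiples of `e`. -/
theorem hasSum_cpow_neg_multiples {s : ℂ} (hs : 1 < s.re) {e : ℕ} (he : e ≠ 0) :
    HasSum (fun c : ℕ => if e ∣ c then (c : ℂ) ^ (-s) else 0)
      ((e : ℂ) ^ (-s) * riemannZeta s) := by
  rw [← (mul_right_injective₀ he).hasSum_iff]
  · refine ((hasSum_natCast_cpow_neg hs).mul_left ((e : ℂ) ^ (-s))).of_eq (fun c => ?_) rfl
    simp [Complex.natCast_mul_natCast_cpow]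
  · intro c hc
    rw [if_neg]
    rintro ⟨k, rfl⟩
    exact hc ⟨k, rfl⟩

/-- The Dirichlet series of `c ↦ gcd(c, d) ^ Q`. -/
theorem hasSum_cpow_neg_mul_gcd_pow {Q d : ℕ} (hQ : Q ≠ 0) (hd : d ≠ 0) {s : ℂ}
    (hs : 1 < s.re) :
    HasSum (fun c : ℕ => (c : ℂ) ^ (-s) * (Nat.gcd c d : ℂ) ^ Q)
      (riemannZeta s * ∏ p ∈ d.primeFactors, (1 + (1 - (p : ℂ) ^ (-(Q : ℤ))) *
        ∑ j ∈ Finset.Icc 1 (d.factorization p), (p : ℂ) ^ ((j : ℂ) * (Q - s)))) := by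
  have h := hasSum_sum (s := d.divisors) fun e he =>
    (hasSum_cpow_neg_multiples hs (Nat.pos_of_mem_divisors he).ne').mul_left (jordanTotient Q e)
  refine h.of_eq (fun c => ?_) ?_
  · have hdiv : (Nat.gcd c d).divisors = d.divisors.filter (· ∣ c) := by
      ext e
      simp [Nat.dvd_gcd_iff, hd, and_comm]
    rw [← sum_divisors_jordanTotient hQ, hdiv, Finset.sum_filter, Finset.mul_sum]
    refine Finset.sum_congr rfl fun e _ => ?_
    split_ifs <;> ring
  · rw [← sum_divisors_jordanTwist hQ hd, Finset.mul_sum]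
    refine Finset.sum_congr rfl fun e _ => ?_
    rw [jordanTwist_apply]
    ring

theorem hasSum_int_zpow_neg {Q : ℕ} (hQ : 1 < Q) :
    HasSum (fun m : ℤ => (m : ℂ) ^ (-(Q : ℤ)))
      (2 * (if 2 ∣ (Q : ℤ) then (1 : ℂ) else 0) * riemannZeta Q) := by
  have hQ0 : -(Q : ℤ) ≠ 0 := by omega
  have hpos : HasSum (fun m : ℕ => ((m : ℤ) : ℂ) ^ (-(Q : ℤ))) (riemannZeta Q) := by
    have := hasSum_natCast_cpow_neg (s := Q) (by simpa using hQ)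
    refine this.of_eq (fun m => ?_) rfl
    rw [Int.cast_natCast, ← Complex.cpow_intCast]
    simp
  have hneg : HasSum (fun m : ℕ => ((-(m : ℤ) : ℤ) : ℂ) ^ (-(Q : ℤ)))
      ((-1) ^ (-(Q : ℤ)) * riemannZeta Q) := by
    refine (hpos.mul_left ((-1) ^ (-(Q : ℤ)))).of_eq (fun m => ?_) rfl
    rw [← mul_zpow]
    simp
  have h := HasSum.of_nat_of_neg (f := fun m : ℤ => (m : ℂ) ^ (-(Q : ℤ))) hpos hneg
  simp only [Int.cast_zero, zero_zpow _ hQ0, sub_zero] at h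
  refine h.of_eq (fun _ => rfl) ?_
  split_ifs with h
  · rw [Even.neg_one_zpow (by simpa [even_iff_two_dvd] using h)]
    ring
  · rw [Odd.neg_one_zpow (by rw [← Int.not_even_iff_odd]; simpa [even_iff_two_dvd] using h)]
    ring

/-- The inner sum without the restriction that `a` and `b` be nonzero. -/
theorem hasSum_linear_solutions {n : ℤ} {c d Q : ℕ} (hc : 0 < c) (hd : 0 < d)
    (hdn : (d : ℤ) ∣ n) (hQ : 1 < Q) :
    HasSum (fun ab : ℤ × ℤ => if ab.1 * d - ab.2 * c = n
        then ((ab.2 * c : ℤ) : ℂ) ^ (-(Q : ℤ)) else 0)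
      ((d : ℂ) ^ (-(Q : ℤ)) * (c : ℂ) ^ (-(Q : ℤ)) * (Nat.gcd c d : ℂ) ^ Q *
        (2 * (if 2 ∣ (Q : ℤ) then (1 : ℂ) else 0) * riemannZeta Q)) := by
  obtain ⟨n', rfl⟩ := hdn
  obtain ⟨g, c', d', hg, hcop, rfl, rfl⟩ := Nat.exists_coprime' (Nat.gcd_pos_of_pos_left d hc)
  have hgcd : Nat.gcd (c' * g) (d' * g) = g := by
    rw [Nat.gcd_mul_right, hcop.gcd_eq_one, one_mul]
  have hd' : 0 < d' := Nat.pos_of_mul_pos_right hd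
  have hg0 : (g : ℤ) ≠ 0 := by exact_mod_cast hg.ne'
  have hd0 : (d' : ℤ) ≠ 0 := by exact_mod_cast hd'.ne'
  have hinj : Function.Injective (fun m : ℤ => (n' + c' * m, (d' : ℤ) * m)) := by
    intro x y hxy
    exact mul_left_cancel₀ hd0 (Prod.ext_iff.mp hxy).2
  rw [hgcd, ← hinj.hasSum_iff]
  · refine ((hasSum_int_zpow_neg hQ).mul_left _).of_eq (fun m => ?_) rfl
    have hgC : (g : ℂ) ^ Q ≠ 0 := pow_ne_zero _ (by exact_mod_cast hg.ne')
    simp only [Function.comp]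
    rw [if_pos (by push_cast; ring)]
    push_cast
    simp only [zpow_neg, zpow_natCast, mul_pow]
    field_simp
  · rintro ⟨a, b⟩ hab
    refine if_neg fun h => hab ?_
    push_cast at h
    have h1 : b * c' = d' * (a - n') := by
      apply mul_left_cancel₀ hg0
      linear_combination -h
    have h2 : (d' : ℤ) ∣ b :=
      (Nat.isCoprime_iff_coprime.mpr hcop.symm).dvd_of_dvd_mul_right ⟨_, h1⟩
    obtain ⟨m, rfl⟩ := h2
    refine ⟨m, Prod.ext ?_ rfl⟩
    apply mul_left_cancel₀ hd0
    linear_combination h1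

/-- The contribution of the solutions with `a = 0`. -/
theorem hasSum_solutions_fst_eq_zero {n : ℤ} {c : ℕ} (hc : 0 < c) (d : ℕ) (P : ℤ) :
    HasSum (fun ab : ℤ × ℤ => if ab.1 = 0 ∧ ab.1 * d - ab.2 * c = n
        then ((ab.2 * c : ℤ) : ℂ) ^ P else 0)
      (if (c : ℤ) ∣ n then (-n : ℂ) ^ P else 0) := by
  have hc0 : (c : ℤ) ≠ 0 := by exact_mod_cast hc.ne'
  split_ifs with h
  · obtain ⟨k, rfl⟩ := h
    convert hasSum_single ((0 : ℤ), -k) ?_ using 1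
    · rw [if_pos ⟨rfl, by ring⟩]
      congr 1
      push_cast
      ring
    · rintro ⟨a, b⟩ hab
      refine if_neg ?_
      rintro ⟨rfl, h⟩
      refine hab (Prod.ext rfl (mul_left_cancel₀ hc0 ?_))
      linear_combination -h
  · convert hasSum_zero using 2 with ab
    refine if_neg ?_
    rintro ⟨h0, h1⟩
    refine h ⟨-ab.2, ?_⟩
    rw [← h1, h0]
    ring

theorem hasSum_nonzero_solutions {n : ℤ} {c d Q : ℕ} (hc : 0 < c) (hd : 0 < d)
    (hdn : (d : ℤ) ∣ n) (hQ : 1 < Q) :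
    HasSum (fun ab : ℤ × ℤ => if ab.1 ≠ 0 ∧ ab.2 ≠ 0 ∧ ab.1 * d - ab.2 * c = n
        then ((ab.2 * c : ℤ) : ℂ) ^ (-(Q : ℤ)) else 0)
      ((d : ℂ) ^ (-(Q : ℤ)) * (c : ℂ) ^ (-(Q : ℤ)) * (Nat.gcd c d : ℂ) ^ Q *
        (2 * (if 2 ∣ (Q : ℤ) then (1 : ℂ) else 0) * riemannZeta Q) -
        if (c : ℤ) ∣ n then (-n : ℂ) ^ (-(Q : ℤ)) else 0) := by
  refine ((hasSum_linear_solutions hc hd hdn hQ).sub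
    (hasSum_solutions_fst_eq_zero (n := n) hc d (-(Q : ℤ)))).of_eq (fun ab => ?_) rfl
  by_cases hb : ab.2 = 0
  · simp [hb, show Q ≠ 0 by omega]
  · by_cases ha : ab.1 = 0 <;> simp [ha, hb]

theorem hasSum_dsigma {n : ℤ} (hn : n ≠ 0) (ν : ℂ) :
    HasSum (fun c : ℕ => if (c : ℤ) ∣ n then (c : ℂ) ^ ν else 0) (dsigma ν n) := by
  have h := hasSum_sum_of_ne_finset_zero (L := SummationFilter.unconditional ℕ)
    (f := fun c : ℕ => if (c : ℤ) ∣ n then (c : ℂ) ^ ν else 0)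
    (s := n.natAbs.divisors) fun c hc => if_neg fun h => hc <| by
      simpa [hn] using Int.natCast_dvd.mp h
  refine h.of_eq (fun _ => rfl) ?_
  refine Finset.sum_congr rfl fun c hc => ?_
  rw [if_pos (Int.natCast_dvd.mpr (Nat.dvd_of_mem_divisors hc))]

/-- Lemma 3.1 of the paper, case `d ∣ n`: for `n ≠ 0`, `d ∣ n`, `r₂ ∈ ℝ` and
`P ∈ ℤ` with `P ≤ −3−|r₂|`, the sums converge absolutely and
`∑_{c∈ℕ} c^{r₂} ∑_{a,b∈ℤ∖{0}, ad−bc=n} (bc)^P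
  = (−1)^{P+1}·n^P·σ_{r₂}(n)
    + 2·δ_{2∣P}·d^P·ζ(−P)·ζ(−r₂−P)·∏_{p∣d} (1 + (1−p^P)(p^{r₂} + ⋯ + p^{v_p(d)r₂}))`. -/
theorem shifted_sum_lemma_poly_dvd (n : ℤ) (hn : n ≠ 0) (d : ℕ) (hd : 0 < d)
    (hdn : (d : ℤ) ∣ n) (r₂ : ℝ) (P : ℤ) (hP : (P : ℝ) ≤ -3 - |r₂|) :
    (∀ c : ℕ, 0 < c → Summable (fun ab : ℤ × ℤ =>
        if ab.1 ≠ 0 ∧ ab.2 ≠ 0 ∧ ab.1 * d - ab.2 * c = n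
          then ((ab.2 * c : ℤ) : ℂ) ^ P else 0)) ∧
    Summable (fun c : ℕ => if 0 < c then (c : ℂ) ^ (r₂ : ℂ) *
        ∑' ab : ℤ × ℤ, (if ab.1 ≠ 0 ∧ ab.2 ≠ 0 ∧ ab.1 * d - ab.2 * c = n
          then ((ab.2 * c : ℤ) : ℂ) ^ P else 0) else 0) ∧
    (∑' c : ℕ, if 0 < c then (c : ℂ) ^ (r₂ : ℂ) *
        ∑' ab : ℤ × ℤ, (if ab.1 ≠ 0 ∧ ab.2 ≠ 0 ∧ ab.1 * d - ab.2 * c = n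
          then ((ab.2 * c : ℤ) : ℂ) ^ P else 0) else 0) =
      (-1 : ℂ) ^ (P + 1) * (n : ℂ) ^ P * dsigma (r₂ : ℂ) n
      + 2 * (if 2 ∣ P then (1 : ℂ) else 0) * (d : ℂ) ^ P * riemannZeta (-(P : ℂ)) *
          riemannZeta (-(r₂ : ℂ) - (P : ℂ)) *
          ∏ p ∈ d.primeFactors,
            (1 + (1 - (p : ℂ) ^ P) *
              ∑ j ∈ Finset.Icc 1 (d.factorization p), (p : ℂ) ^ ((j : ℂ) * (r₂ : ℂ))) := by
  obtain ⟨Q, rfl⟩ : ∃ Q : ℕ, P = -(Q : ℤ) := by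
    have h : P ≤ 0 := by
      have : (P : ℝ) ≤ 0 := by linarith [abs_nonneg r₂]
      exact_mod_cast this
    exact ⟨P.natAbs, by omega⟩
  push_cast at hP
  have hQ : 1 < Q := by
    have : (1 : ℝ) < Q := by linarith [abs_nonneg r₂]
    exact_mod_cast this
  have hinner := fun (c : ℕ) (hc : 0 < c) => hasSum_nonzero_solutions hc hd hdn hQ
  have hs : 1 < ((Q : ℂ) - r₂).re := by
    simp only [Complex.sub_re, Complex.natCast_re, Complex.ofReal_re]
    linarith [le_abs_self r₂]
  have houter := ((hasSum_cpow_neg_mul_gcd_pow (by omega : Q ≠ 0) hd.ne' hs).mul_left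
    ((d : ℂ) ^ (-(Q : ℤ)) * (2 * (if 2 ∣ (Q : ℤ) then (1 : ℂ) else 0) * riemannZeta Q))).sub
    ((hasSum_dsigma hn r₂).mul_left ((-n : ℂ) ^ (-(Q : ℤ))))
  refine ⟨fun c hc => (hinner c hc).summable,
    (houter.of_eq (fun c => ?_) ?_).summable_and_tsum_eq⟩
  · rcases Nat.eq_zero_or_pos c with rfl | hc
    · have hs0 : -((Q : ℂ) - r₂) ≠ 0 := by
        intro h
        rw [neg_eq_zero.mp h, Complex.zero_re] at hs
        linarith
      rw [Nat.cast_zero, Complex.zero_cpow hs0]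
      simp [hn]
    · have hc0 : (c : ℂ) ≠ 0 := by exact_mod_cast hc.ne'
      have hpow : (c : ℂ) ^ (-((Q : ℂ) - r₂)) = (c : ℂ) ^ (r₂ : ℂ) * (c : ℂ) ^ (-(Q : ℤ)) := by
        rw [← Complex.cpow_intCast, ← Complex.cpow_add _ _ hc0]
        push_cast
        ring_nf
      rw [if_pos hc, (hinner c hc).tsum_eq, hpow]
      split_ifs <;> ring
  · have hneg : (-n : ℂ) ^ (-(Q : ℤ)) = -((-1 : ℂ) ^ (-(Q : ℤ) + 1) * (n : ℂ) ^ (-(Q : ℤ))) := by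
      rw [neg_eq_neg_one_mul (n : ℂ), mul_zpow, zpow_add₀ (by norm_num)]
      ring
    have hexp : -(r₂ : ℂ) - ((-(Q : ℤ) : ℤ) : ℂ) = (Q : ℂ) - r₂ := by
      push_cast
      ring
    rw [hneg, hexp]
    simp only [sub_sub_cancel, dvd_neg, Int.cast_neg, Int.cast_natCast, neg_neg]
    ring
end
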